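/- arXiv:2503.05657 — 2 statements merged into one kernel-verified Lean document; each statement's English description precedes it below -/
import Mathlib

section
/- Let X be a metric space, F a normed space, and f : X → F a Borel measurable map admitting a decomposition f = g + h where g is Lipschitz with constant K and h is bounded with ‖h(x)‖ ≤ M for all x. Then for all Borel probability measures μ, ν on X with finite first moments, W(f♯μ, f♯ν) ≤ K · W(μ, ν) + 2M · TV(μ, ν). -/
open MeasureTheory
open scoped ENNReal NNReal

/-- Wasserstein-1 distance between two measures on a metric space, defined as the infimum of
`∫ d(x,y) dπ` over all couplings `π`, with values in `[0,∞]`. -/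
noncomputable def wassersteinDist {X : Type*} [MeasurableSpace X] [PseudoMetricSpace X]
    (μ ν : Measure X) : ℝ≥0∞ :=
  ⨅ (π : Measure (X × X)) (_ : π.map Prod.fst = μ) (_ : π.map Prod.snd = ν),
    ∫⁻ p, ENNReal.ofReal (dist p.1 p.2) ∂π

/-- Total variation distance between two measures:
`TV(μ,ν) = sup over measurable sets A of |μ(A) − ν(A)|`. -/
noncomputable def tvDist {X : Type*} [MeasurableSpace X] (μ ν : Measure X) : ℝ :=
  ⨆ A : {s : Set X // MeasurableSet s}, |(μ A.1).toReal - (ν A.1).toReal|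

open ProbabilityTheory

/-- Every metric space, separable or not, can be moved by less than `ε` through a map that is
measurable for the discrete σ-algebra on the target. -/
theorem exists_discretization {X : Type*} [PseudoMetricSpace X] [MeasurableSpace X] [BorelSpace X]
    {ε : ℝ} (hε : 0 < ε) :
    ∃ r : X → X, (∀ s : Set X, MeasurableSet (r ⁻¹' s)) ∧ ∀ x, dist x (r x) < ε := by
  classical
  obtain ⟨_, hwf⟩ := exists_wellFoundedLT X
  have hne : ∀ x : X, {z | dist x z < ε}.Nonempty := fun x => ⟨x, by simpa using hε⟩
  let r : X → X := fun x => wellFounded_lt.min _ (hne x)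
  have hr : ∀ x, dist x (r x) < ε := fun x => wellFounded_lt.min_mem _ (hne x)
  have hle : ∀ x z, dist x z < ε → r x ≤ z := fun x z hz =>
    wellFounded_lt.min_le (s := {z | dist x z < ε}) hz
  refine ⟨r, fun s => ?_, hr⟩
  let A : ℕ → Set X := fun n => {y | r y ∈ s ∧ ∀ w, dist w y < 1 / (n + 1 : ℝ) → dist w (r y) < ε}
  have hA : r ⁻¹' s = ⋃ n, A n := by
    ext y
    simp only [Set.mem_preimage, Set.mem_iUnion]
    refine ⟨fun hy => ?_, fun ⟨n, hn⟩ => hn.1⟩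
    obtain ⟨n, hn⟩ := exists_nat_one_div_lt (sub_pos.2 (hr y))
    refine ⟨n, hy, fun w hw => ?_⟩
    linarith [dist_triangle w y (r y)]
  rw [hA]
  refine MeasurableSet.iUnion fun n => IsClosed.measurableSet ?_
  have hδ : (0 : ℝ) < 1 / (n + 1 : ℝ) := by positivity
  set δ : ℝ := 1 / (n + 1 : ℝ)
  have hsame : ∀ y ∈ A n, ∀ y' ∈ A n, dist y y' < δ → r y = r y' := fun y hy y' hy' h =>
    le_antisymm (hle _ _ (hy'.2 y h)) (hle _ _ (hy.2 y' (by rwa [dist_comm])))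
  rw [← closure_subset_iff_isClosed]
  intro y hy
  rw [Metric.mem_closure_iff] at hy
  obtain ⟨a, ha, hya⟩ := hy (δ / 2) (by positivity)
  have hclose : ∀ b ∈ A n, dist y b < δ / 2 → r b = r a := fun b hb hyb =>
    hsame b hb a ha (by linarith [dist_triangle_left b a y])
  have hra : r y = r a := by
    refine le_antisymm (hle _ _ (ha.2 y (by linarith))) ?_
    obtain ⟨b, hb, hyb⟩ := hy (min (δ / 2) (ε - dist y (r y)))
      (lt_min (by positivity) (sub_pos.2 (hr y)))
    rw [← hclose b hb (hyb.trans_le (min_le_left _ _))]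
    refine hle _ _ ?_
    linarith [dist_triangle_left b (r y) y, hyb.trans_le (min_le_right _ _)]
  refine ⟨hra ▸ ha.1, fun w hw => ?_⟩
  obtain ⟨b, hb, hyb⟩ := hy (min (δ / 2) (δ - dist w y)) (lt_min (by positivity) (sub_pos.2 hw))
  rw [hra, ← hclose b hb (hyb.trans_le (min_le_left _ _))]
  exact hb.2 w (by linarith [dist_triangle w y b, hyb.trans_le (min_le_right _ _)])

section CondDistrib

variable {A J Ω : Type*} [MeasurableSpace A] [MeasurableSpace J] [DiscreteMeasurableSpace J]
  [MeasurableSpace Ω]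

theorem measurable_uncurry_of_upperSemicontinuous [TopologicalSpace Ω] [SecondCountableTopology Ω]
    [OpensMeasurableSpace Ω] {g : J → Ω → ℝ≥0} (hg : ∀ y, UpperSemicontinuous (g y)) :
    Measurable fun p : J × Ω => g p.1 p.2 := by
  refine measurable_of_Iio fun t => ?_
  have hb := TopologicalSpace.isBasis_countableBasis Ω
  have : (fun p : J × Ω => g p.1 p.2) ⁻¹' Set.Iio t =
      ⋃ U ∈ TopologicalSpace.countableBasis Ω, {y | U ⊆ g y ⁻¹' Set.Iio t} ×ˢ U := by
    ext ⟨y, ω⟩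
    simp only [Set.mem_preimage, Set.mem_iUnion, Set.mem_prod, Set.mem_ofPred_eq, exists_prop]
    constructor
    · intro h
      obtain ⟨U, hU, hω, hUs⟩ := hb.exists_subset_of_mem_open (show ω ∈ g y ⁻¹' Set.Iio t from h)
        (upperSemicontinuous_iff_isOpen_preimage.1 (hg y) t)
      exact ⟨U, hU, hUs, hω⟩
    · rintro ⟨U, -, hUs, hω⟩
      exact hUs hω
  rw [this]
  exact MeasurableSet.biUnion (TopologicalSpace.countable_countableBasis Ω) fun U hU =>
    (MeasurableSet.of_discrete).prod (hb.isOpen hU).measurableSet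

/-- A one-sided disintegration inequality over a discrete base: `f` is only assumed measurable
in its second variable. -/
theorem lintegral_condDistrib_le [StandardBorelSpace Ω] [Nonempty Ω] (ρ : Measure A)
    [IsFiniteMeasure ρ] {X : A → J} {Y : A → Ω}
    (hX : Measurable X) (hY : Measurable Y) {f : J → Ω → ℝ≥0∞} (hf : ∀ y, Measurable (f y))
    {c : A → ℝ≥0∞} (hfc : ∀ a, f (X a) (Y a) ≤ c a) :
    ∫⁻ y, ∫⁻ ω, f y ω ∂(condDistrib Y X ρ y) ∂(ρ.map X) ≤ ∫⁻ a, c a ∂ρ := by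
  let _ := upgradeStandardBorel Ω
  let _ := TopologicalSpace.upgradeIsCompletelyMetrizable Ω
  have key : ∀ n : ℕ, ∫⁻ y, ∫⁻ ω, min (f y ω) n ∂(condDistrib Y X ρ y) ∂(ρ.map X)
      ≤ ∫⁻ a, c a ∂ρ := by
    intro n
    have hfin : ∀ y ω, min (f y ω) n ≠ ∞ := fun y ω =>
      ((min_le_right _ _).trans_lt (ENNReal.natCast_lt_top n)).ne
    refine ENNReal.le_of_forall_pos_le_add fun ε hε _ => ?_
    set δ : ℝ≥0∞ := ε / (ρ Set.univ + 1)
    have hδ : δ ≠ 0 := (ENNReal.div_pos (by simpa using hε.ne') (by simp)).ne'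
    have hg : ∀ y, ∃ g : Ω → ℝ≥0, (∀ ω, g ω ≤ (min (f y ω) n).toNNReal) ∧
        UpperSemicontinuous g ∧ ∫⁻ ω, min (f y ω) n ∂(condDistrib Y X ρ y) ≤
          ∫⁻ ω, g ω ∂(condDistrib Y X ρ y) + δ := by
      intro y
      have h := exists_upperSemicontinuous_le_lintegral_le (μ := condDistrib Y X ρ y)
        (fun ω => (min (f y ω) n).toNNReal) ?_ hδ
      · simpa only [ENNReal.coe_toNNReal (hfin y _)] using h
      · simp only [ENNReal.coe_toNNReal (hfin y _)]
        refine ((lintegral_mono fun ω => min_le_right (f y ω) n).trans_lt ?_).ne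
        simp
    choose g hgf hgs hgi using hg
    have hgm := measurable_uncurry_of_upperSemicontinuous hgs
    have hgm' : Measurable fun p : J × Ω => (g p.1 p.2 : ℝ≥0∞) := hgm.coe_nnreal_ennreal
    calc ∫⁻ y, ∫⁻ ω, min (f y ω) n ∂(condDistrib Y X ρ y) ∂(ρ.map X)
        ≤ ∫⁻ y, (∫⁻ ω, g y ω ∂(condDistrib Y X ρ y) + δ) ∂(ρ.map X) := lintegral_mono hgi
      _ = ∫⁻ y, ∫⁻ ω, g y ω ∂(condDistrib Y X ρ y) ∂(ρ.map X) + δ * ρ Set.univ := by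
          rw [lintegral_add_right _ measurable_const, lintegral_const,
            Measure.map_apply hX MeasurableSet.univ, Set.preimage_univ]
      _ = ∫⁻ a, g (X a) (Y a) ∂ρ + δ * ρ Set.univ := by
          rw [← Measure.lintegral_compProd hgm', compProd_map_condDistrib hY.aemeasurable,
            lintegral_map hgm' (hX.prodMk hY)]
      _ ≤ ∫⁻ a, c a ∂ρ + ε := by
          gcongr with a
          · refine le_trans ?_ (hfc a)
            refine le_trans ?_ (min_le_left _ (n : ℝ≥0∞))
            rw [← ENNReal.coe_toNNReal (hfin _ _)]
            exact_mod_cast hgf _ _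
          · calc δ * ρ Set.univ ≤ δ * (ρ Set.univ + 1) := by gcongr; exact le_self_add
              _ = ε := ENNReal.div_mul_cancel (by simp) (by simp)
  have hsup : ∀ a : ℝ≥0∞, ⨆ n : ℕ, min a n = a := fun a => by
    rw [← inf_iSup_eq, ENNReal.iSup_natCast, inf_top_eq]
  have hmono : ∀ y, Monotone fun (n : ℕ) ω => min (f y ω) n := fun y m n h ω =>
    min_le_min_left _ (by exact_mod_cast h)
  have h1 : ∀ y, ∫⁻ ω, f y ω ∂(condDistrib Y X ρ y)
      = ⨆ n : ℕ, ∫⁻ ω, min (f y ω) n ∂(condDistrib Y X ρ y) := by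
    intro y
    rw [← lintegral_iSup (fun n => (hf y).min measurable_const) (hmono y)]
    simp_rw [hsup]
  simp_rw [h1]
  rw [lintegral_iSup (f := fun (n : ℕ) y => ∫⁻ ω, min (f y ω) n ∂(condDistrib Y X ρ y))
    (fun n => .of_discrete) fun m n h y => lintegral_mono (hmono y h)]
  exact iSup_le key

end CondDistrib

section Coding

variable {X Z : Type*}

/-- Merge a sequence of Cantor-space valued maps into one. -/
def cantorJoin (u : ℕ → X → ℕ → Bool) (x : X) (k : ℕ) : Bool := u k.unpair.1 x k.unpair.2

/-- The `n`-th component of a point of Cantor space. -/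
def cantorProj (n : ℕ) (ω : ℕ → Bool) (j : ℕ) : Bool := ω (Nat.pair n j)

theorem measurable_cantorProj (n : ℕ) : Measurable (cantorProj n) :=
  measurable_pi_lambda _ fun _ => measurable_pi_apply _

theorem cantorProj_comp_cantorJoin (u : ℕ → X → ℕ → Bool) (n : ℕ) :
    cantorProj n ∘ cantorJoin u = u n := by
  ext x j
  simp [cantorProj, cantorJoin]

open Classical in
/-- The map to Cantor space coding the indicator function of a set. -/
noncomputable def cantorCode (S : Set X) (x : X) (_ : ℕ) : Bool := decide (x ∈ S)

theorem cantorCode_preimage (S : Set X) : cantorCode S ⁻¹' {ω | ω 0 = true} = S := by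
  ext x
  simp [cantorCode]

variable [MeasurableSpace X] [MeasurableSpace Z]

theorem measurable_cantorJoin {u : ℕ → X → ℕ → Bool} (hu : ∀ n, Measurable (u n)) :
    Measurable (cantorJoin u) :=
  measurable_pi_lambda _ fun k => (measurable_pi_apply _).comp (hu k.unpair.1)

theorem measurable_cantorCode {S : Set X} (hS : MeasurableSet S) : Measurable (cantorCode S) := by
  refine measurable_pi_lambda _ fun k => measurable_to_bool ?_
  convert! hS using 1
  ext x
  simp [cantorCode]

theorem measurableSet_cantor_zero : MeasurableSet {ω : ℕ → Bool | ω 0 = true} :=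
  measurableSet_eq_fun (measurable_pi_apply 0) measurable_const

/-- Two Cantor-space valued maps through which a measurable subset of the product factors. -/
structure RectFactor (u : X → ℕ → Bool) (v : Z → ℕ → Bool) (C : Set (X × Z))
    (B : Set ((ℕ → Bool) × (ℕ → Bool))) : Prop where
  measurable_left : Measurable u
  measurable_right : Measurable v
  measurableSet : MeasurableSet B
  preimage_eq : Prod.map u v ⁻¹' B = C

theorem exists_rectFactor_seq {C : ℕ → Set (X × Z)} (h : ∀ n, ∃ u v B, RectFactor u v (C n) B) :
    ∃ u v, ∃ B : ℕ → Set _, ∀ n, RectFactor u v (C n) (B n) := by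
  choose u v B h using h
  refine ⟨cantorJoin u, cantorJoin v, fun n => Prod.map (cantorProj n) (cantorProj n) ⁻¹' B n,
    fun n => ⟨measurable_cantorJoin fun n => (h n).1, measurable_cantorJoin fun n => (h n).2,
      ((measurable_cantorProj n).prodMap (measurable_cantorProj n)) (h n).3, ?_⟩⟩
  rw [← Set.preimage_comp, Prod.map_comp_map, cantorProj_comp_cantorJoin,
    cantorProj_comp_cantorJoin, (h n).4]

theorem exists_rectFactor {C : Set (X × Z)} (hC : MeasurableSet C) :
    ∃ u v B, RectFactor u v C B := by
  rw [← generateFrom_prod] at hC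
  induction C, hC using MeasurableSpace.generateFrom_induction with
  | hC C hC _ =>
    obtain ⟨S, hS, T, hT, rfl⟩ := hC
    refine ⟨cantorCode S, cantorCode T, {ω | ω 0 = true} ×ˢ {ω | ω 0 = true},
      measurable_cantorCode hS, measurable_cantorCode hT,
      measurableSet_cantor_zero.prod measurableSet_cantor_zero, ?_⟩
    rw [Set.preimage_prod_map_prod, cantorCode_preimage, cantorCode_preimage]
  | empty => exact ⟨cantorCode ∅, cantorCode ∅, ∅, measurable_cantorCode .empty,
      measurable_cantorCode .empty, .empty, rfl⟩
  | compl C _ ih =>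
    obtain ⟨u, v, B, h⟩ := ih
    exact ⟨u, v, Bᶜ, h.1, h.2, h.3.compl, by rw [Set.preimage_compl, h.4]⟩
  | iUnion C _ ih =>
    obtain ⟨u, v, B, h⟩ := exists_rectFactor_seq ih
    exact ⟨u, v, ⋃ n, B n, (h 0).1, (h 0).2, .iUnion fun n => (h n).3, by
      simp only [Set.preimage_iUnion, (h _).4]⟩

/-- A measurable function on a product factors through a product of maps to Cantor space. -/
theorem exists_measurable_comp_prodMap {f : X × Z → ℝ≥0∞} (hf : Measurable f) :
    ∃ (u : X → ℕ → Bool) (v : Z → ℕ → Bool) (g : (ℕ → Bool) × (ℕ → Bool) → ℝ≥0∞),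
      Measurable u ∧ Measurable v ∧ Measurable g ∧ f = g ∘ Prod.map u v := by
  have hs := MeasurableSpace.measurableSet_natGeneratingSequence (α := ℝ≥0∞)
  obtain ⟨u, v, B, h⟩ := exists_rectFactor_seq fun n => exists_rectFactor (hf (hs n))
  have hfm : Measurable[MeasurableSpace.comap (Prod.map u v) inferInstance] f := by
    rw [measurable_iff_comap_le, ← MeasurableSpace.generateFrom_natGeneratingSequence ℝ≥0∞,
      MeasurableSpace.comap_generateFrom]
    refine MeasurableSpace.generateFrom_le ?_
    rintro _ ⟨_, ⟨n, rfl⟩, rfl⟩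
    exact ⟨B n, (h n).3, (h n).4⟩
  obtain ⟨g, hg, hfg⟩ := hfm.exists_eq_measurable_comp
  exact ⟨u, v, g, (h 0).1, (h 0).2, hg, hfg⟩

end Coding

section Gluing

variable {X J Z : Type*} [MeasurableSpace X] [MeasurableSpace J] [MeasurableSpace Z]

/-- The joint law of `u` and `v` when `κ` and `π` are glued conditionally independently
along the middle space `J`. -/
noncomputable def gluedLaw (κ : Measure (X × J)) (π : Measure (J × Z)) [IsFiniteMeasure κ]
    [IsFiniteMeasure π] (u : X → ℕ → Bool) (v : Z → ℕ → Bool) :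
    Measure ((ℕ → Bool) × (ℕ → Bool)) :=
  (condDistrib (u ∘ Prod.fst) Prod.snd κ ×ₖ condDistrib (v ∘ Prod.snd) Prod.fst π) ∘ₘ
    (κ.map Prod.snd)

variable {κ : Measure (X × J)} {π : Measure (J × Z)} [IsFiniteMeasure κ] [IsFiniteMeasure π]

instance (u : X → ℕ → Bool) (v : Z → ℕ → Bool) : IsFiniteMeasure (gluedLaw κ π u v) := by
  unfold gluedLaw; infer_instance

theorem lintegral_prod_le_add_lintegral {Ω Ω' : Type*} [MeasurableSpace Ω] [MeasurableSpace Ω']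
    (p : Measure Ω) (q : Measure Ω') [IsProbabilityMeasure p] [IsProbabilityMeasure q]
    {ψ : Ω × Ω' → ℝ≥0∞} (hψ : Measurable ψ) {a : Ω → ℝ≥0∞} {b : Ω' → ℝ≥0∞}
    (h : ∀ ω ω', ψ (ω, ω') ≤ a ω + b ω') :
    ∫⁻ x, ψ x ∂(p.prod q) ≤ ∫⁻ ω, a ω ∂p + ∫⁻ ω', b ω' ∂q := by
  rw [lintegral_prod _ hψ.aemeasurable]
  calc ∫⁻ ω, ∫⁻ ω', ψ (ω, ω') ∂q ∂p ≤ ∫⁻ ω, (a ω + ∫⁻ ω', b ω' ∂q) ∂p := by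
        refine lintegral_mono fun ω => (lintegral_mono (h ω)).trans ?_
        rw [lintegral_add_left measurable_const]
        simp
    _ = _ := by
        rw [lintegral_add_right _ measurable_const]
        simp

theorem lintegral_gluedLaw_le [DiscreteMeasurableSpace J] (hκπ : κ.map Prod.snd = π.map Prod.fst)
    {u : X → ℕ → Bool} {v : Z → ℕ → Bool} (hu : Measurable u) (hv : Measurable v)
    {c₁ : X → J → ℝ≥0∞} {c₂ : J → Z → ℝ≥0∞} {ψ : (ℕ → Bool) × (ℕ → Bool) → ℝ≥0∞}
    (hψ : Measurable ψ) (h : ∀ x y z, ψ (u x, v z) ≤ c₁ x y + c₂ y z) :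
    ∫⁻ p, ψ p ∂(gluedLaw κ π u v) ≤
      ∫⁻ p, c₁ p.1 p.2 ∂κ + ∫⁻ p, c₂ p.1 p.2 ∂π := by
  set k₁ := condDistrib (u ∘ Prod.fst) Prod.snd κ
  set k₂ := condDistrib (v ∘ Prod.snd) Prod.fst π
  let a : J → (ℕ → Bool) → ℝ≥0∞ := fun y ω => ⨅ x : {x // u x = ω}, c₁ x y
  let b : J → (ℕ → Bool) → ℝ≥0∞ := fun y ω => ⨅ z : {z // v z = ω}, c₂ y z
  have hab : ∀ y ω ω', ψ (ω, ω') ≤ a y ω + b y ω' := by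
    intro y ω ω'
    simp only [a, b]
    rw [ENNReal.iInf_add]
    refine le_iInf fun ⟨x, hx⟩ => ?_
    rw [ENNReal.add_iInf]
    refine le_iInf fun ⟨z, hz⟩ => ?_
    subst hx hz
    exact h _ _ _
  choose a' ham ha hai using fun y => exists_measurable_le_lintegral_eq (k₁ y) (a y)
  choose b' hbm hb hbi using fun y => exists_measurable_le_lintegral_eq (k₂ y) (b y)
  calc ∫⁻ p, ψ p ∂(gluedLaw κ π u v)
      = ∫⁻ y, ∫⁻ p, ψ p ∂((k₁ y).prod (k₂ y)) ∂(κ.map Prod.snd) := by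
        rw [gluedLaw, Measure.lintegral_bind (Kernel.aemeasurable _) hψ.aemeasurable]
        simp only [Kernel.prod_apply, k₁, k₂]
    _ ≤ ∫⁻ y, (∫⁻ ω, a' y ω ∂(k₁ y) + ∫⁻ ω, b' y ω ∂(k₂ y)) ∂(κ.map Prod.snd) := by
        refine lintegral_mono fun y => ?_
        rw [← hai, ← hbi]
        exact lintegral_prod_le_add_lintegral _ _ hψ (hab y)
    _ = ∫⁻ y, ∫⁻ ω, a' y ω ∂(k₁ y) ∂(κ.map Prod.snd) +
          ∫⁻ y, ∫⁻ ω, b' y ω ∂(k₂ y) ∂(π.map Prod.fst) := by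
        rw [lintegral_add_left .of_discrete, ← hκπ]
    _ ≤ _ := by
        refine add_le_add (lintegral_condDistrib_le κ measurable_snd (hu.comp measurable_fst) ham
          fun p => ?_) (lintegral_condDistrib_le π measurable_fst (hv.comp measurable_snd) hbm
          fun p => ?_)
        · exact (ha _ _).trans (iInf_le_of_le ⟨p.1, rfl⟩ le_rfl)
        · exact (hb _ _).trans (iInf_le_of_le ⟨p.2, rfl⟩ le_rfl)

theorem gluedLaw_map_fst {u : X → ℕ → Bool} (hu : Measurable u) (v : Z → ℕ → Bool) :
    (gluedLaw κ π u v).map Prod.fst = κ.map (u ∘ Prod.fst) := by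
  rw [gluedLaw, Measure.map_comp _ _ measurable_fst, ← Kernel.fst_eq, Kernel.fst_prod,
    condDistrib_comp_map measurable_snd.aemeasurable (hu.comp measurable_fst).aemeasurable]

theorem gluedLaw_map_snd (hκπ : κ.map Prod.snd = π.map Prod.fst) (u : X → ℕ → Bool)
    {v : Z → ℕ → Bool} (hv : Measurable v) :
    (gluedLaw κ π u v).map Prod.snd = π.map (v ∘ Prod.snd) := by
  rw [gluedLaw, Measure.map_comp _ _ measurable_snd, ← Kernel.snd_eq, Kernel.snd_prod, hκπ,
    condDistrib_comp_map measurable_fst.aemeasurable (hv.comp measurable_snd).aemeasurable]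

theorem gluedLaw_comp (hκπ : κ.map Prod.snd = π.map Prod.fst)
    {u : X → ℕ → Bool} {v : Z → ℕ → Bool} (hu : Measurable u) (hv : Measurable v)
    {φ χ : (ℕ → Bool) → ℕ → Bool} (hφ : Measurable φ) (hχ : Measurable χ) :
    gluedLaw κ π (φ ∘ u) (χ ∘ v) = (gluedLaw κ π u v).map (Prod.map φ χ) := by
  rw [gluedLaw, gluedLaw, Measure.map_comp _ _ (hφ.prodMap hχ), ← Kernel.map_prod_map _ _ hφ hχ]
  refine Measure.comp_congr ?_
  have h₁ := condDistrib_comp (mβ := ‹_›) (μ := κ) Prod.snd (hu.comp measurable_fst).aemeasurable hφ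
  have h₂ := condDistrib_comp (mβ := ‹_›) (μ := π) Prod.fst (hv.comp measurable_snd).aemeasurable hχ
  rw [← hκπ] at h₂
  filter_upwards [h₁, h₂] with y h₁ h₂
  rw [Kernel.prod_apply, Kernel.prod_apply, ← h₁, ← h₂]
  rfl

theorem gluedLaw_eq_zero [DiscreteMeasurableSpace J] (hκπ : κ.map Prod.snd = π.map Prod.fst)
    {u : X → ℕ → Bool} {v : Z → ℕ → Bool} (hu : Measurable u) (hv : Measurable v)
    {B : Set ((ℕ → Bool) × (ℕ → Bool))} (hB : MeasurableSet B) (h : Prod.map u v ⁻¹' B = ∅) :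
    gluedLaw κ π u v B = 0 := by
  rw [← nonpos_iff_eq_zero, ← lintegral_indicator_one hB]
  refine (lintegral_gluedLaw_le hκπ hu hv (measurable_one.indicator hB) (c₁ := 0) (c₂ := 0)
    fun x _ z => ?_).trans (by simp)
  have : (u x, v z) ∉ B := fun hB => (h ▸ hB : (x, z) ∈ (∅ : Set (X × Z)))
  simp [this]

theorem gluedLaw_congr [DiscreteMeasurableSpace J] (hκπ : κ.map Prod.snd = π.map Prod.fst)
    {u u' : X → ℕ → Bool} {v v' : Z → ℕ → Bool} {C : Set (X × Z)}
    {B B' : Set ((ℕ → Bool) × (ℕ → Bool))}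
    (h : RectFactor u v C B) (h' : RectFactor u' v' C B') :
    gluedLaw κ π u v B = gluedLaw κ π u' v' B' := by
  let U : ℕ → X → ℕ → Bool := fun n => if n = 0 then u else u'
  let V : ℕ → Z → ℕ → Bool := fun n => if n = 0 then v else v'
  have hU : Measurable (cantorJoin U) := measurable_cantorJoin fun n => by
    by_cases hn : n = 0 <;> simp [U, hn, h.1, h'.1]
  have hV : Measurable (cantorJoin V) := measurable_cantorJoin fun n => by
    by_cases hn : n = 0 <;> simp [V, hn, h.2, h'.2]
  have hp := measurable_cantorProj
  have hpp : ∀ n, Measurable (Prod.map (cantorProj n) (cantorProj n)) := fun n =>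
    (hp n).prodMap (hp n)
  have key : ∀ n, gluedLaw κ π (U n) (V n) =
      (gluedLaw κ π (cantorJoin U) (cantorJoin V)).map (Prod.map (cantorProj n) (cantorProj n)) :=
    fun n => by
      rw [← gluedLaw_comp hκπ hU hV (hp n) (hp n), cantorProj_comp_cantorJoin,
        cantorProj_comp_cantorJoin]
  have h0 := key 0
  have h1 := key 1
  simp only [U, V, if_true, one_ne_zero, if_false] at h0 h1
  rw [h0, h1, Measure.map_apply (hpp _) h.3, Measure.map_apply (hpp _) h'.3]
  refine measure_congr (measure_symmDiff_eq_zero_iff.1 (gluedLaw_eq_zero hκπ hU hV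
    ((hpp 0 h.3).symmDiff (hpp 1 h'.3)) ?_))
  rw [Set.preimage_symmDiff, ← Set.preimage_comp, ← Set.preimage_comp, Prod.map_comp_map,
    Prod.map_comp_map]
  simp only [cantorProj_comp_cantorJoin]
  simp [U, V, h.4, h'.4]

/-- Gluing lemma along a discrete, possibly uncountable, middle space, for arbitrary outer spaces
and cost functions that need not be measurable. -/
theorem exists_gluing [DiscreteMeasurableSpace J] (hκπ : κ.map Prod.snd = π.map Prod.fst)
    {c₁ : X → J → ℝ≥0∞} {c₂ : J → Z → ℝ≥0∞} {c : X → Z → ℝ≥0∞}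
    (h : ∀ x y z, c x z ≤ c₁ x y + c₂ y z) :
    ∃ τ : Measure (X × Z), τ.map Prod.fst = κ.map Prod.fst ∧ τ.map Prod.snd = π.map Prod.snd ∧
      ∫⁻ p, c p.1 p.2 ∂τ ≤ ∫⁻ p, c₁ p.1 p.2 ∂κ + ∫⁻ p, c₂ p.1 p.2 ∂π := by
  choose u v B hB using fun C : {C : Set (X × Z) // MeasurableSet C} => exists_rectFactor C.2
  let τ : Measure (X × Z) := Measure.ofMeasurable
    (fun C hC => gluedLaw κ π (u ⟨C, hC⟩) (v ⟨C, hC⟩) (B ⟨C, hC⟩))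
    (gluedLaw_eq_zero hκπ (hB _).1 (hB _).2 (hB _).3 (hB _).4) (by
      intro C hC hd
      obtain ⟨u', v', B', h'⟩ := exists_rectFactor_seq fun n => exists_rectFactor (hC n)
      have hU : RectFactor u' v' (⋃ n, C n) (⋃ n, B' n) :=
        ⟨(h' 0).1, (h' 0).2, .iUnion fun n => (h' n).3, by
          simp only [Set.preimage_iUnion, (h' _).4]⟩
      rw [gluedLaw_congr hκπ (hB ⟨_, .iUnion hC⟩) hU, measure_iUnion₀ ?_ fun n =>
        (h' n).3.nullMeasurableSet]
      · exact tsum_congr fun n => gluedLaw_congr hκπ (h' n) (hB ⟨_, hC n⟩)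
      · refine fun i j hij => gluedLaw_eq_zero hκπ hU.1 hU.2 ((h' i).3.inter (h' j).3) ?_
        rw [Set.preimage_inter, (h' i).4, (h' j).4, (hd hij).inter_eq])
  have hτ : ∀ {u v}, Measurable u → Measurable v →
      τ.map (Prod.map u v) = gluedLaw κ π u v := by
    intro u v hu hv
    ext D hD
    have hC := (hu.prodMap hv) hD
    rw [Measure.map_apply (hu.prodMap hv) hD, Measure.ofMeasurable_apply _ hC]
    exact gluedLaw_congr hκπ (hB ⟨_, hC⟩) ⟨hu, hv, hD, rfl⟩
  have hc : Measurable fun (_ : Z) (_ : ℕ) => true := measurable_const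
  have hc' : Measurable fun (_ : X) (_ : ℕ) => true := measurable_const
  refine ⟨τ, ?_, ?_, ?_⟩
  · ext S hS
    have hS' := measurable_cantorCode hS
    have := DFunLike.congr_fun (gluedLaw_map_fst (κ := κ) (π := π) hS' fun _ _ => true)
      {ω | ω 0 = true}
    rw [← hτ hS' hc, Measure.map_map measurable_fst (hS'.prodMap hc), Prod.map_fst',
      ← Measure.map_map hS' measurable_fst, ← Measure.map_map hS' measurable_fst,
      Measure.map_apply hS' measurableSet_cantor_zero,
      Measure.map_apply hS' measurableSet_cantor_zero, cantorCode_preimage] at this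
    exact this
  · ext S hS
    have hS' := measurable_cantorCode hS
    have := DFunLike.congr_fun (gluedLaw_map_snd hκπ (fun _ _ => true) hS') {ω | ω 0 = true}
    rw [← hτ hc' hS', Measure.map_map measurable_snd (hc'.prodMap hS'), Prod.map_snd',
      ← Measure.map_map hS' measurable_snd, ← Measure.map_map hS' measurable_snd,
      Measure.map_apply hS' measurableSet_cantor_zero,
      Measure.map_apply hS' measurableSet_cantor_zero, cantorCode_preimage] at this
    exact this
  · obtain ⟨ψ, hψ, hψc, hψi⟩ := exists_measurable_le_lintegral_eq τ fun p => c p.1 p.2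
    obtain ⟨u, v, g, hu, hv, hg, rfl⟩ := exists_measurable_comp_prodMap hψ
    rw [hψi]
    simp only [Function.comp_apply]
    rw [← lintegral_map hg (hu.prodMap hv), hτ hu hv]
    exact lintegral_gluedLaw_le hκπ hu hv hg fun x y z => (hψc (x, z)).trans (h x y z)

end Gluing

section Refinement

variable {A B : Type*} [MeasurableSpace A] [MeasurableSpace B]

theorem exists_density_of_add (μ ν : Measure A) [IsFiniteMeasure μ] [IsFiniteMeasure ν] :
    ∃ d e : A → ℝ≥0∞, Measurable d ∧ Measurable e ∧ (d + e =ᵐ[μ + ν] 1) ∧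
      (μ + ν).withDensity d = μ ∧ (μ + ν).withDensity e = ν := by
  have hμ : μ ≪ μ + ν := Measure.le_add_right le_rfl |>.absolutelyContinuous
  have hν : ν ≪ μ + ν := Measure.le_add_left le_rfl |>.absolutelyContinuous
  refine ⟨μ.rnDeriv (μ + ν), ν.rnDeriv (μ + ν), Measure.measurable_rnDeriv _ _,
    Measure.measurable_rnDeriv _ _, ?_, Measure.withDensity_rnDeriv_eq _ _ hμ,
    Measure.withDensity_rnDeriv_eq _ _ hν⟩
  exact (Measure.rnDeriv_add' μ ν (μ + ν)).symm.trans (Measure.rnDeriv_self _)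

theorem map_withDensity_comp (ρ : Measure A) {f : A → B} (hf : Measurable f) {d : B → ℝ≥0∞}
    (hd : Measurable d) : (ρ.withDensity (d ∘ f)).map f = (ρ.map f).withDensity d := by
  ext s hs
  rw [Measure.map_apply hf hs, withDensity_apply _ (hf hs), withDensity_apply _ hs,
    setLIntegral_map hs hd hf]
  rfl

theorem withDensity_add_withDensity_of_ae {ρ : Measure A} {d e : A → ℝ≥0∞} (hd : Measurable d)
    (h : d + e =ᵐ[ρ] 1) : ρ.withDensity d + ρ.withDensity e = ρ := by
  rw [← withDensity_add_left hd, withDensity_congr_ae h, withDensity_one]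

theorem exists_add_eq_map_eq (ρ : Measure A) {f : A → B} (hf : Measurable f) {μ ν : Measure B}
    [IsFiniteMeasure μ] [IsFiniteMeasure ν] (h : ρ.map f = μ + ν) :
    ∃ ρ₁ ρ₂ : Measure A, ρ₁ + ρ₂ = ρ ∧ ρ₁.map f = μ ∧ ρ₂.map f = ν := by
  obtain ⟨d, e, hd, he, hde, hdμ, heν⟩ := exists_density_of_add μ ν
  rw [← h] at hde hdμ heν
  refine ⟨ρ.withDensity (d ∘ f), ρ.withDensity (e ∘ f),
    withDensity_add_withDensity_of_ae (hd.comp hf) (ae_of_ae_map hf.aemeasurable hde), ?_, ?_⟩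
  · rw [map_withDensity_comp ρ hf hd, hdμ]
  · rw [map_withDensity_comp ρ hf he, heν]

theorem exists_refinement {μ ν α β : Measure A} [IsFiniteMeasure μ] [IsFiniteMeasure ν]
    (h : μ + ν = α + β) :
    ∃ μ₁ μ₂ ν₁ ν₂ : Measure A, μ₁ + μ₂ = μ ∧ ν₁ + ν₂ = ν ∧ μ₁ + ν₁ = α ∧ μ₂ + ν₂ = β := by
  obtain ⟨d, e, hd, he, hde, hdμ, heν⟩ := exists_density_of_add μ ν
  rw [h] at hde hdμ heν
  refine ⟨α.withDensity d, β.withDensity d, α.withDensity e, β.withDensity e, ?_, ?_,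
    withDensity_add_withDensity_of_ae hd ?_, withDensity_add_withDensity_of_ae hd ?_⟩
  · rw [← withDensity_add_measure, hdμ]
  · rw [← withDensity_add_measure, heν]
  · exact Measure.le_add_right le_rfl |>.absolutelyContinuous.ae_le hde
  · exact Measure.le_add_left le_rfl |>.absolutelyContinuous.ae_le hde

theorem sum_eq_of_remainder_tendsto_zero {R E : ℕ → Measure A} [IsFiniteMeasure (R 0)]
    (hR : ∀ n, R (n + 1) + E n = R n)
    (h0 : Filter.Tendsto (fun n => R n Set.univ) Filter.atTop (nhds 0)) :
    Measure.sum E = R 0 := by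
  ext s hs
  have key : ∀ n, ∑ k ∈ Finset.range n, E k s + R n s = R 0 s := by
    intro n
    induction n with
    | zero => simp
    | succ n ih => rw [Finset.sum_range_succ, add_assoc, add_comm (E n s), ← Measure.add_apply,
        hR, ih]
  have hs0 : Filter.Tendsto (fun n => R n s) Filter.atTop (nhds 0) :=
    tendsto_of_tendsto_of_tendsto_of_le_of_le tendsto_const_nhds h0 (fun _ => zero_le)
      fun _ => measure_mono (Set.subset_univ s)
  have hlim := (ENNReal.summable (f := fun k => E k s)).hasSum.tendsto_sum_nat.add hs0
  simp only [key, add_zero] at hlim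
  rw [Measure.sum_apply _ hs]
  exact tendsto_nhds_unique hlim tendsto_const_nhds

end Refinement

section Transport

variable {X J : Type*} [MeasurableSpace X] [MeasurableSpace J]

/-- A partial transport: `moving` is the plan built so far, whose target must still be moved
along `plan`, a plan from `common + moving.map Prod.snd` to `common + target`. -/
structure PartialTransport (X J : Type*) [MeasurableSpace X] [MeasurableSpace J] where
  moving : Measure (X × J)
  plan : Measure (J × J)
  common : Measure J
  target : Measure J
  finite_moving : IsFiniteMeasure moving
  finite_plan : IsFiniteMeasure plan
  finite_common : IsFiniteMeasure common
  finite_target : IsFiniteMeasure target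
  plan_fst : plan.map Prod.fst = common + moving.map Prod.snd
  plan_snd : plan.map Prod.snd = common + target

theorem PartialTransport.target_univ (s : PartialTransport X J) :
    s.target Set.univ = s.moving Set.univ := by
  have := s.finite_common
  have h₁ := DFunLike.congr_fun s.plan_fst Set.univ
  have h₂ := DFunLike.congr_fun s.plan_snd Set.univ
  rw [Measure.map_apply measurable_fst .univ, Measure.add_apply,
    Measure.map_apply measurable_snd .univ] at h₁
  rw [Measure.map_apply measurable_snd .univ, Measure.add_apply] at h₂
  simp only [Set.preimage_univ] at h₁ h₂
  exact (ENNReal.add_right_inj (measure_ne_top s.common _)).1 (h₂.symm.trans h₁)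

theorem isFiniteMeasure_of_add_left {A : Type*} [MeasurableSpace A] {μ ν ρ : Measure A}
    [IsFiniteMeasure ρ] (h : μ + ν = ρ) : IsFiniteMeasure μ :=
  isFiniteMeasure_of_le ρ (h ▸ Measure.le_add_right le_rfl)

theorem isFiniteMeasure_of_add_right {A : Type*} [MeasurableSpace A] {μ ν ρ : Measure A}
    [IsFiniteMeasure ρ] (h : μ + ν = ρ) : IsFiniteMeasure ν :=
  isFiniteMeasure_of_le ρ (h ▸ Measure.le_add_left le_rfl)

theorem PartialTransport.exists_step [DiscreteMeasurableSpace J] {c : X → J → ℝ≥0∞}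
    {d : J → J → ℝ≥0∞} (hcd : ∀ x y y', c x y' ≤ c x y + d y y') (s : PartialTransport X J) :
    ∃ (s' : PartialTransport X J) (E : Measure (X × J)),
      s'.moving.map Prod.fst + E.map Prod.fst = s.moving.map Prod.fst ∧
      s'.target + E.map Prod.snd = s.target ∧
      s'.moving.map Prod.snd + s'.common = s.common ∧
      ∫⁻ p, c p.1 p.2 ∂E + (∫⁻ p, c p.1 p.2 ∂s'.moving + ∫⁻ p, d p.1 p.2 ∂s'.plan) ≤
        ∫⁻ p, c p.1 p.2 ∂s.moving + ∫⁻ p, d p.1 p.2 ∂s.plan := by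
  obtain ⟨A, P, m, b, _, _, _, _, hP₁, hP₂⟩ := s
  obtain ⟨P₂, P₁, hP, hP₂m, hP₁A⟩ := exists_add_eq_map_eq P measurable_fst hP₁
  have := isFiniteMeasure_of_add_left hP
  have := isFiniteMeasure_of_add_right hP
  obtain ⟨A', hA'₁, hA'₂, hA'c⟩ := exists_gluing hP₁A.symm hcd
  have hsum : P₁.map Prod.snd + P₂.map Prod.snd = m + b := by
    rw [← hP₂, ← hP, Measure.map_add _ _ measurable_snd, add_comm]
  obtain ⟨l₁, l₂, m', b', hl, hmb, hm, hb⟩ := exists_refinement hsum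
  have := isFiniteMeasure_of_add_left hl
  have := isFiniteMeasure_of_add_right hl
  have := isFiniteMeasure_of_add_left hmb
  have := isFiniteMeasure_of_add_right hmb
  have : IsFiniteMeasure (A'.map Prod.fst) := hA'₁ ▸ inferInstance
  have : IsFiniteMeasure A' := Measure.isFiniteMeasure_of_map measurable_fst.aemeasurable
  obtain ⟨A'', E, hAE, hA'', hE⟩ := exists_add_eq_map_eq A' measurable_snd (hA'₂.trans hl.symm)
  have := isFiniteMeasure_of_add_left hAE
  refine ⟨⟨A'', P₂, m', b', inferInstance, inferInstance, inferInstance, inferInstance, ?_,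
    hmb.symm⟩, E, ?_, ?_, ?_, ?_⟩
  · rw [hP₂m, hA'', ← hm, add_comm]
  · rw [← Measure.map_add _ _ measurable_fst, hAE, hA'₁]
  · rw [hE, add_comm, hb]
  · dsimp only
    rw [hA'', hm]
  · dsimp only
    rw [← add_assoc, add_comm (∫⁻ p, c p.1 p.2 ∂E), ← lintegral_add_measure, hAE, ← hP,
      lintegral_add_measure, add_comm (∫⁻ p, d p.1 p.2 ∂P₂), ← add_assoc]
    exact add_le_add hA'c le_rfl

/-- Removing the common part of the marginals of a transport plan does not increase its cost. -/
theorem PartialTransport.exists_plan [DiscreteMeasurableSpace J] {c : X → J → ℝ≥0∞}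
    {d : J → J → ℝ≥0∞} (hcd : ∀ x y y', c x y' ≤ c x y + d y y') (s : PartialTransport X J) :
    ∃ D : Measure (X × J), D.map Prod.fst = s.moving.map Prod.fst ∧ D.map Prod.snd = s.target ∧
      ∫⁻ p, c p.1 p.2 ∂D ≤ ∫⁻ p, c p.1 p.2 ∂s.moving + ∫⁻ p, d p.1 p.2 ∂s.plan := by
  choose next E hfst hsnd hcommon hcost using PartialTransport.exists_step (X := X) hcd
  let S : ℕ → PartialTransport X J := fun n => next^[n] s
  have hS : ∀ n, S (n + 1) = next (S n) := fun n => Function.iterate_succ_apply' next n s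
  have hmass : ∀ n, (S (n + 1)).moving Set.univ + (S (n + 1)).common Set.univ =
      (S n).common Set.univ := by
    intro n
    rw [← hcommon (S n), ← hS, Measure.add_apply, Measure.map_apply measurable_snd .univ,
      Set.preimage_univ]
  have hpartial : ∀ n, ∑ k ∈ Finset.range n, (S (k + 1)).moving Set.univ +
      (S n).common Set.univ = s.common Set.univ := by
    intro n
    induction n with
    | zero => simp [S]
    | succ n ih => rw [Finset.sum_range_succ, add_assoc, hmass, ih]
  have htend : Filter.Tendsto (fun n => (S n).moving Set.univ) Filter.atTop (nhds 0) := by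
    rw [← Filter.tendsto_add_atTop_iff_nat 1]
    refine ENNReal.tendsto_atTop_zero_of_tsum_ne_top (ne_top_of_le_ne_top
      (s.finite_common.measure_univ_lt_top.ne) (ENNReal.tsum_le_of_sum_range_le fun n => ?_))
    rw [← hpartial n]
    exact le_self_add
  have hcosts : ∀ n, ∑ k ∈ Finset.range n, ∫⁻ p, c p.1 p.2 ∂(E (S k)) +
      (∫⁻ p, c p.1 p.2 ∂(S n).moving + ∫⁻ p, d p.1 p.2 ∂(S n).plan) ≤
      ∫⁻ p, c p.1 p.2 ∂s.moving + ∫⁻ p, d p.1 p.2 ∂s.plan := by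
    intro n
    induction n with
    | zero => simp [S]
    | succ n ih =>
      rw [Finset.sum_range_succ, add_assoc, hS]
      exact (add_le_add le_rfl (hcost (S n))).trans ih
  refine ⟨Measure.sum fun n => E (S n), ?_, ?_, ?_⟩
  · have : IsFiniteMeasure (S 0).moving := s.finite_moving
    rw [Measure.map_sum measurable_fst.aemeasurable]
    refine sum_eq_of_remainder_tendsto_zero (R := fun n => (S n).moving.map Prod.fst)
      (fun n => by simp only [hS, hfst]) ?_
    simpa only [Measure.map_apply measurable_fst .univ, Set.preimage_univ] using htend
  · have : IsFiniteMeasure (S 0).target := s.finite_target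
    rw [Measure.map_sum measurable_snd.aemeasurable]
    refine sum_eq_of_remainder_tendsto_zero (R := fun n => (S n).target)
      (fun n => by simp only [hS, hsnd]) ?_
    simpa only [PartialTransport.target_univ] using htend
  · rw [lintegral_sum_measure]
    exact ENNReal.tsum_le_of_sum_range_le fun n => le_self_add.trans (hcosts n)

end Transport

theorem edist_lip_add_bounded_le {X F : Type*} [PseudoMetricSpace X] [SeminormedAddCommGroup F]
    {f g h : X → F} {K : ℝ≥0} {M : ℝ} (hg : LipschitzWith K g) (hh : ∀ x, ‖h x‖ ≤ M)
    (hdecomp : ∀ x, f x = g x + h x) (x y : X) :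
    edist (f x) (f y) ≤ K * edist x y + ENNReal.ofReal (2 * M) := by
  rw [hdecomp, hdecomp]
  refine (edist_add_add_le _ _ _ _).trans (add_le_add (hg x y) ?_)
  rw [edist_dist]
  refine ENNReal.ofReal_le_ofReal ((dist_le_norm_add_norm _ _).trans ?_)
  linarith [hh x, hh y]

section Assembly

universe u
variable {X : Type*} [MeasurableSpace X]

theorem exists_discretization_map {X : Type u} [MeasurableSpace X] [PseudoMetricSpace X]
    [BorelSpace X] {ε : ℝ≥0∞} (hε : ε ≠ 0) :
    ∃ (J : Type u) (_ : MeasurableSpace J) (_ : DiscreteMeasurableSpace J) (r : X → J) (s : J → X),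
      Measurable r ∧ ∀ x, edist x (s (r x)) ≤ ε := by
  obtain ⟨δ, hδ, hδε⟩ := ENNReal.lt_iff_exists_real_btwn.1 (pos_iff_ne_zero.2 hε)
  obtain ⟨r, hr, hrd⟩ := exists_discretization (X := X) (ENNReal.ofReal_pos.1 hδε.1)
  refine ⟨X, ⊤, @DiscreteMeasurableSpace.mk X ⊤ fun _ => trivial, r, id, fun s _ => hr s,
    fun x => ?_⟩
  rw [edist_dist]
  exact (ENNReal.ofReal_le_ofReal (hrd x).le).trans hδε.2.le

theorem exists_coupling_excess [PseudoMetricSpace X] [BorelSpace X] {π : Measure (X × X)}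
    [IsProbabilityMeasure π] {m α β : Measure X} (h₁ : m + α = π.map Prod.fst)
    (h₂ : m + β = π.map Prod.snd) {ε : ℝ≥0∞} (hε : ε ≠ 0) :
    ∃ σ : Measure (X × X), σ.map Prod.fst = α ∧ σ.map Prod.snd = β ∧
      ∫⁻ p, edist p.1 p.2 ∂σ ≤ ∫⁻ p, edist p.1 p.2 ∂π + 4 * ε := by
  obtain ⟨J, _, _, r, s, hr, hrs⟩ := exists_discretization_map (X := X) hε
  have : IsProbabilityMeasure (π.map Prod.fst) :=
    Measure.isProbabilityMeasure_map measurable_fst.aemeasurable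
  have : IsProbabilityMeasure (π.map Prod.snd) :=
    Measure.isProbabilityMeasure_map measurable_snd.aemeasurable
  have := isFiniteMeasure_of_add_left h₁
  have := isFiniteMeasure_of_add_right h₁
  have := isFiniteMeasure_of_add_right h₂
  have hα : α Set.univ ≤ 1 := by
    rw [← measure_univ (μ := π.map Prod.fst), ← h₁]; exact le_add_self
  have hβ : β Set.univ ≤ 1 := by
    rw [← measure_univ (μ := π.map Prod.snd), ← h₂]; exact le_add_self
  have hleft : Measurable fun x => (x, r x) := measurable_id.prodMk hr
  have hright : Measurable fun x => (r x, x) := hr.prodMk measurable_id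
  obtain ⟨D, hD₁, hD₂, hDc⟩ := PartialTransport.exists_plan (X := X) (J := J)
    (c := fun x y => edist x (s y)) (d := fun y y' => edist (s y) (s y'))
    (fun _ _ _ => edist_triangle _ _ _)
    { moving := α.map fun x => (x, r x)
      plan := π.map (Prod.map r r)
      common := m.map r
      target := β.map r
      finite_moving := inferInstance
      finite_plan := inferInstance
      finite_common := inferInstance
      finite_target := inferInstance
      plan_fst := by
        rw [Measure.map_map measurable_fst (hr.prodMap hr), Prod.map_fst',
          ← Measure.map_map hr measurable_fst, ← h₁, Measure.map_add _ _ hr,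
          Measure.map_map measurable_snd hleft]
        rfl
      plan_snd := by
        rw [Measure.map_map measurable_snd (hr.prodMap hr), Prod.map_snd',
          ← Measure.map_map hr measurable_snd, ← h₂, Measure.map_add _ _ hr] }
  dsimp only at hD₁ hD₂ hDc
  have hD₁' : D.map Prod.fst = α := by
    rw [hD₁, Measure.map_map measurable_fst hleft]
    exact Measure.map_id
  have : IsFiniteMeasure (D.map Prod.fst) := hD₁' ▸ inferInstance
  have : IsFiniteMeasure D := Measure.isFiniteMeasure_of_map measurable_fst.aemeasurable
  obtain ⟨σ, hσ₁, hσ₂, hσc⟩ := exists_gluing (κ := D) (π := β.map fun x => (r x, x))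
    (c₁ := fun x y => edist x (s y)) (c₂ := fun y z => edist (s y) z) (c := edist)
    (by rw [hD₂, Measure.map_map measurable_fst hright]; rfl)
    fun _ _ _ => edist_triangle _ _ _
  refine ⟨σ, hσ₁.trans hD₁', ?_, ?_⟩
  · rw [hσ₂, Measure.map_map measurable_snd hright]
    exact Measure.map_id
  · have b₁ : ∫⁻ p, edist p.1 (s p.2) ∂(α.map fun x => (x, r x)) ≤ ε :=
      (lintegral_map_le _ _).trans ((lintegral_mono hrs).trans (by
        rw [lintegral_const]; exact mul_le_of_le_one_right' hα))
    have b₂ : ∫⁻ p, edist (s p.1) p.2 ∂(β.map fun x => (r x, x)) ≤ ε :=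
      (lintegral_map_le _ _).trans ((lintegral_mono fun x => (edist_comm _ _).trans_le
        (hrs x)).trans (by rw [lintegral_const]; exact mul_le_of_le_one_right' hβ))
    have b₃ : ∫⁻ p, edist (s p.1) (s p.2) ∂(π.map (Prod.map r r)) ≤
        ∫⁻ p, edist p.1 p.2 ∂π + (ε + ε) :=
      calc ∫⁻ p, edist (s p.1) (s p.2) ∂(π.map (Prod.map r r))
          ≤ ∫⁻ p, edist (s (r p.1)) (s (r p.2)) ∂π := lintegral_map_le _ _
        _ ≤ ∫⁻ p, (edist p.1 p.2 + (ε + ε)) ∂π := lintegral_mono fun p =>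
            calc edist (s (r p.1)) (s (r p.2))
                ≤ edist (s (r p.1)) p.1 + edist p.1 p.2 + edist p.2 (s (r p.2)) :=
                  edist_triangle4 _ _ _ _
              _ ≤ ε + edist p.1 p.2 + ε := by
                  gcongr
                  · exact (edist_comm _ _).trans_le (hrs _)
                  · exact hrs _
              _ = edist p.1 p.2 + (ε + ε) := by ring
        _ = _ := by
            rw [lintegral_add_right _ measurable_const, lintegral_const, measure_univ, mul_one]
    calc ∫⁻ p, edist p.1 p.2 ∂σ ≤ ε + (∫⁻ p, edist p.1 p.2 ∂π + (ε + ε)) + ε :=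
          hσc.trans (add_le_add (hDc.trans (add_le_add b₁ b₃)) b₂)
      _ = _ := by ring

theorem ofReal_sub_le_tvDist (μ ν : Measure X) [IsProbabilityMeasure μ] [IsProbabilityMeasure ν]
    {s : Set X} (hs : MeasurableSet s) : μ s - ν s ≤ ENNReal.ofReal (tvDist μ ν) := by
  rw [← ENNReal.ofReal_toReal (measure_ne_top μ s), ← ENNReal.ofReal_toReal (measure_ne_top ν s),
    ← ENNReal.ofReal_sub _ ENNReal.toReal_nonneg]
  refine ENNReal.ofReal_le_ofReal ((le_abs_self _).trans (le_ciSup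
    (f := fun A : {s : Set X // MeasurableSet s} => |(μ A.1).toReal - (ν A.1).toReal|)
    ⟨1, ?_⟩ ⟨s, hs⟩))
  rintro _ ⟨A, rfl⟩
  have h : ∀ (ρ : Measure X) [IsProbabilityMeasure ρ], (ρ A.1).toReal ∈ Set.Icc (0 : ℝ) 1 :=
    fun ρ _ => ⟨ENNReal.toReal_nonneg, measureReal_le_one⟩
  exact abs_sub_le_of_nonneg_of_le (h μ).1 (h μ).2 (h ν).1 (h ν).2

theorem exists_common_part (μ ν : Measure X) [IsProbabilityMeasure μ] [IsProbabilityMeasure ν] :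
    ∃ m α β : Measure X, m + α = μ ∧ m + β = ν ∧
      α Set.univ ≤ ENNReal.ofReal (tvDist μ ν) := by
  obtain ⟨s, hs, hνμ, hμν⟩ := hahn_decomposition μ ν
  have h₁ : ν.restrict s ≤ μ.restrict s := Measure.le_iff.2 fun t ht => by
    rw [Measure.restrict_apply ht, Measure.restrict_apply ht]
    exact hνμ _ (ht.inter hs) Set.inter_subset_right
  have h₂ : μ.restrict sᶜ ≤ ν.restrict sᶜ := Measure.le_iff.2 fun t ht => by
    rw [Measure.restrict_apply ht, Measure.restrict_apply ht]
    exact hμν _ (ht.inter hs.compl) Set.inter_subset_right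
  refine ⟨ν.restrict s + μ.restrict sᶜ, μ.restrict s - ν.restrict s,
    ν.restrict sᶜ - μ.restrict sᶜ, ?_, ?_, ?_⟩
  · rw [add_right_comm, add_comm (ν.restrict s), Measure.sub_add_cancel_of_le h₁,
      Measure.restrict_add_restrict_compl hs]
  · rw [add_assoc, add_comm (μ.restrict sᶜ), Measure.sub_add_cancel_of_le h₂,
      Measure.restrict_add_restrict_compl hs]
  · rw [Measure.sub_apply .univ h₁, Measure.restrict_apply_univ, Measure.restrict_apply_univ]
    exact ofReal_sub_le_tvDist μ ν hs

theorem wassersteinDist_map_le_of_coupling [PseudoMetricSpace X] [BorelSpace X] {F : Type*}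
    [PseudoMetricSpace F] [MeasurableSpace F] {f : X → F} (hf : Measurable f) {K : ℝ≥0} {L : ℝ≥0∞}
    (hfKL : ∀ x y, edist (f x) (f y) ≤ K * edist x y + L) {μ ν : Measure X}
    [IsProbabilityMeasure μ] [IsProbabilityMeasure ν] {π : Measure (X × X)}
    (h₁ : π.map Prod.fst = μ) (h₂ : π.map Prod.snd = ν) :
    wassersteinDist (μ.map f) (ν.map f) ≤
      K * ∫⁻ p, edist p.1 p.2 ∂π + L * ENNReal.ofReal (tvDist μ ν) := by
  obtain ⟨m, α, β, hα, hβ, htv⟩ := exists_common_part μ ν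
  have : IsProbabilityMeasure (π.map Prod.fst) := h₁ ▸ inferInstance
  have : IsProbabilityMeasure π := Measure.isProbabilityMeasure_of_map Prod.fst
  refine ENNReal.le_of_forall_pos_le_add fun δ hδ _ => ?_
  have hδ' : (δ : ℝ≥0∞) / (4 * (K + 1)) ≠ 0 :=
    (ENNReal.div_pos (by simpa using hδ.ne') (ENNReal.mul_ne_top (by simp) (by simp))).ne'
  obtain ⟨σ, hσ₁, hσ₂, hσc⟩ := exists_coupling_excess (π := π) (hα.trans h₁.symm)
    (hβ.trans h₂.symm) hδ'
  set ε := (δ : ℝ≥0∞) / (4 * (K + 1))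
  have hdiag : Measurable fun x => (f x, f x) := hf.prodMk hf
  have hff := hf.prodMap hf
  have hσu : σ Set.univ ≤ ENNReal.ofReal (tvDist μ ν) := by
    rwa [← hσ₁, Measure.map_apply measurable_fst .univ, Set.preimage_univ] at htv
  have hKε : (K : ℝ≥0∞) * (4 * ε) ≤ δ :=
    calc (K : ℝ≥0∞) * (4 * ε) ≤ (K + 1) * (4 * ε) := by gcongr; exact le_self_add
      _ = 4 * (K + 1) * ε := by ring
      _ = δ := ENNReal.mul_div_cancel (by simp) (ENNReal.mul_ne_top (by simp) (by simp))
  calc wassersteinDist (μ.map f) (ν.map f)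
      ≤ ∫⁻ p, edist p.1 p.2 ∂(σ.map (Prod.map f f) + m.map fun x => (f x, f x)) := by
        simp only [edist_dist]
        refine iInf_le_of_le _ (iInf_le_of_le ?_ (iInf_le_of_le ?_ le_rfl))
        · rw [Measure.map_add _ _ measurable_fst, Measure.map_map measurable_fst hff,
            Measure.map_map measurable_fst hdiag, Prod.map_fst',
            ← Measure.map_map hf measurable_fst, hσ₁, ← hα, Measure.map_add _ _ hf, add_comm]
          rfl
        · rw [Measure.map_add _ _ measurable_snd, Measure.map_map measurable_snd hff,
            Measure.map_map measurable_snd hdiag, Prod.map_snd',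
            ← Measure.map_map hf measurable_snd, hσ₂, ← hβ, Measure.map_add _ _ hf, add_comm]
          rfl
    _ ≤ ∫⁻ p, edist (f p.1) (f p.2) ∂σ + ∫⁻ x, edist (f x) (f x) ∂m := by
        rw [lintegral_add_measure]
        exact add_le_add (lintegral_map_le _ _) (lintegral_map_le _ _)
    _ ≤ ∫⁻ p, (K * edist p.1 p.2 + L) ∂σ := by
        simpa using lintegral_mono fun p : X × X => hfKL p.1 p.2
    _ = K * ∫⁻ p, edist p.1 p.2 ∂σ + L * σ Set.univ := by
        rw [lintegral_add_right _ measurable_const, lintegral_const,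
          lintegral_const_mul' _ _ ENNReal.coe_ne_top]
    _ ≤ K * (∫⁻ p, edist p.1 p.2 ∂π + 4 * ε) + L * ENNReal.ofReal (tvDist μ ν) := by gcongr
    _ = K * ∫⁻ p, edist p.1 p.2 ∂π + L * ENNReal.ofReal (tvDist μ ν) + K * (4 * ε) := by ring
    _ ≤ _ := by gcongr

end Assembly

/-- Lemma 9 (quantitative form): for `f = g + h` with `g` `K`-Lipschitz and `‖h‖∞ ≤ M`,
`W(f♯μ, f♯ν) ≤ K·W(μ,ν) + 2M·TV(μ,ν)`. -/
theorem lip_plus_bounded_pushforward_bound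
    {X F : Type*} [MetricSpace X] [MeasurableSpace X] [BorelSpace X]
    [NormedAddCommGroup F] [MeasurableSpace F] [BorelSpace F]
    (f g h : X → F) (K : ℝ≥0) (M : ℝ)
    (hf : Measurable f) (hg : LipschitzWith K g) (hh : ∀ x, ‖h x‖ ≤ M)
    (hdecomp : ∀ x, f x = g x + h x)
    (μ ν : Measure X) [IsProbabilityMeasure μ] [IsProbabilityMeasure ν]
    (hμ : ∃ x₀, ∫⁻ x, ENNReal.ofReal (dist x x₀) ∂μ ≠ ∞)
    (hν : ∃ x₀, ∫⁻ x, ENNReal.ofReal (dist x x₀) ∂ν ≠ ∞) :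
    wassersteinDist (μ.map f) (ν.map f)
      ≤ (K : ℝ≥0∞) * wassersteinDist μ ν + ENNReal.ofReal (2 * M * tvDist μ ν) := by
  obtain ⟨x₀, -⟩ := hμ
  have hM : 0 ≤ M := (norm_nonneg _).trans (hh x₀)
  have key := fun (π : Measure (X × X)) => wassersteinDist_map_le_of_coupling (π := π) hf
    (edist_lip_add_bounded_le hg hh hdecomp) (μ := μ) (ν := ν)
  rw [ENNReal.ofReal_mul (by positivity)]
  obtain rfl | hK := eq_or_ne K 0
  · simpa using key (μ.prod ν) (by simp) (by simp)
  · conv_rhs => rw [wassersteinDist]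
    simp only [ENNReal.mul_iInf_of_ne (ENNReal.coe_ne_zero.2 hK) ENNReal.coe_ne_top,
      ENNReal.iInf_add, ← edist_dist]
    exact le_iInf fun π => le_iInf fun h₁ => le_iInf fun h₂ => key π h₁ h₂
end

section
/- Let X be a metric space and let α, β, γ be finite Borel measures on X with β and γ having equal total mass. Then W(α + β, α + γ) ≥ W(β, γ), where W denotes the Wasserstein-1 distance between finite measures of equal total mass (with values in [0, ∞]). -/
open MeasureTheory
open scoped ENNReal

section Transport

open Set Filter

section Splitting

variable {Y Z : Type*} [MeasurableSpace Y] [MeasurableSpace Z]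

/-- The densities of two finite measures with respect to their sum add up to one. -/
theorem exists_density_add_eq_one (ν₁ ν₂ : Measure Z) [IsFiniteMeasure ν₁] [IsFiniteMeasure ν₂] :
    ∃ f₁ f₂ : Z → ℝ≥0∞, Measurable f₁ ∧ Measurable f₂ ∧
      (ν₁ + ν₂).withDensity f₁ = ν₁ ∧ (ν₁ + ν₂).withDensity f₂ = ν₂ ∧
      f₁ + f₂ =ᵐ[ν₁ + ν₂] 1 := by
  have h₁ : ν₁ ≪ ν₁ + ν₂ := Measure.absolutelyContinuous_of_le (Measure.le_add_right le_rfl)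
  have h₂ : ν₂ ≪ ν₁ + ν₂ := Measure.absolutelyContinuous_of_le (Measure.le_add_left le_rfl)
  refine ⟨ν₁.rnDeriv (ν₁ + ν₂), ν₂.rnDeriv (ν₁ + ν₂), Measure.measurable_rnDeriv _ _,
    Measure.measurable_rnDeriv _ _, Measure.withDensity_rnDeriv_eq _ _ h₁,
    Measure.withDensity_rnDeriv_eq _ _ h₂, ?_⟩
  exact (Measure.rnDeriv_add' ν₁ ν₂ (ν₁ + ν₂)).symm.trans (Measure.rnDeriv_self _)

theorem withDensity_add_eq_self {μ : Measure Z} {f₁ f₂ : Z → ℝ≥0∞} (hf₁ : Measurable f₁)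
    (h : f₁ + f₂ =ᵐ[μ] 1) : μ.withDensity f₁ + μ.withDensity f₂ = μ := by
  rw [← withDensity_add_left hf₁, withDensity_congr_ae h, withDensity_one]

/-- A decomposition of the image of a measure lifts to a decomposition of the measure. -/
theorem exists_add_of_map_eq_add (μ : Measure Y) {T : Y → Z} (hT : Measurable T)
    (ν₁ ν₂ : Measure Z) [IsFiniteMeasure ν₁] [IsFiniteMeasure ν₂] (h : μ.map T = ν₁ + ν₂) :
    ∃ μ₁ μ₂ : Measure Y, μ₁ + μ₂ = μ ∧ μ₁.map T = ν₁ ∧ μ₂.map T = ν₂ := by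
  obtain ⟨f₁, f₂, hf₁, hf₂, e₁, e₂, hsum⟩ := exists_density_add_eq_one ν₁ ν₂
  rw [← h] at e₁ e₂ hsum
  have key : ∀ f : Z → ℝ≥0∞, Measurable f →
      (μ.withDensity (f ∘ T)).map T = (μ.map T).withDensity f := by
    intro f hf
    ext s hs
    rw [Measure.map_apply hT hs, withDensity_apply _ (hT hs), withDensity_apply _ hs,
      setLIntegral_map hs hf hT]
    rfl
  refine ⟨μ.withDensity (f₁ ∘ T), μ.withDensity (f₂ ∘ T),
    withDensity_add_eq_self (hf₁.comp hT) (ae_of_ae_map hT.aemeasurable hsum), ?_, ?_⟩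
  · rw [key f₁ hf₁, e₁]
  · rw [key f₂ hf₂, e₂]

/-- Riesz decomposition property of finite measures. -/
theorem exists_common_refinement (μ₁ μ₂ ν₁ ν₂ : Measure Z) [IsFiniteMeasure ν₁]
    [IsFiniteMeasure ν₂] (h : μ₁ + μ₂ = ν₁ + ν₂) :
    ∃ ρ₁₁ ρ₁₂ ρ₂₁ ρ₂₂ : Measure Z, ρ₁₁ + ρ₁₂ = μ₁ ∧ ρ₂₁ + ρ₂₂ = μ₂ ∧
      ρ₁₁ + ρ₂₁ = ν₁ ∧ ρ₁₂ + ρ₂₂ = ν₂ := by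
  obtain ⟨f₁, f₂, hf₁, hf₂, e₁, e₂, hsum⟩ := exists_density_add_eq_one ν₁ ν₂
  rw [← h] at e₁ e₂ hsum
  have hsum₁ := (ae_add_measure_iff.1 hsum).1
  have hsum₂ := (ae_add_measure_iff.1 hsum).2
  refine ⟨μ₁.withDensity f₁, μ₁.withDensity f₂, μ₂.withDensity f₁, μ₂.withDensity f₂,
    withDensity_add_eq_self hf₁ hsum₁,
    withDensity_add_eq_self hf₁ hsum₂, ?_, ?_⟩
  · rw [← withDensity_add_measure, e₁]
  · rw [← withDensity_add_measure, e₂]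

end Splitting

section Gluing

variable {A Z C : Type*} [MeasurableSpace A] [MeasurableSpace Z] [MeasurableSpace C]

/-- `e (z, c)` is a version of the conditional expectation of `a ↦ g (a, c)` given the second
coordinate `z` under `J`, valid simultaneously along all sections `s : Z → C`. -/
structure IsSectionCondExp (J : Measure (A × Z)) (g : A × C → ℝ≥0∞) (e : Z × C → ℝ≥0∞) :
    Prop where
  measurable : Measurable e
  setLIntegral_eq : ∀ (s : Z → C) (B : Set Z),
    ∫⁻ z in B, e (z, s z) ∂(J.map Prod.snd) =
      ∫⁻ p in Prod.snd ⁻¹' B, g (p.1, s p.2) ∂J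

namespace IsSectionCondExp

variable {J : Measure (A × Z)}

theorem add {g₁ g₂ : A × C → ℝ≥0∞} {e₁ e₂ : Z × C → ℝ≥0∞} [DiscreteMeasurableSpace Z]
    (h₁ : IsSectionCondExp J g₁ e₁) (h₂ : IsSectionCondExp J g₂ e₂) (hg₁ : Measurable g₁) :
    IsSectionCondExp J (g₁ + g₂) (e₁ + e₂) where
  measurable := h₁.measurable.add h₂.measurable
  setLIntegral_eq s B := by
    have hs : Measurable s := .of_discrete
    simp only [Pi.add_apply]
    rw [lintegral_add_left (by exact .of_discrete), lintegral_add_left (by fun_prop),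
      h₁.setLIntegral_eq, h₂.setLIntegral_eq]

theorem const_mul {g : A × C → ℝ≥0∞} {e : Z × C → ℝ≥0∞} [DiscreteMeasurableSpace Z]
    (h : IsSectionCondExp J g e) (hg : Measurable g) (r : ℝ≥0∞) :
    IsSectionCondExp J (fun p ↦ r * g p) (fun p ↦ r * e p) where
  measurable := h.measurable.const_mul r
  setLIntegral_eq s B := by
    have hs : Measurable s := .of_discrete
    rw [lintegral_const_mul _ (by exact .of_discrete), lintegral_const_mul _ (by fun_prop),
      h.setLIntegral_eq]

theorem tsum {g : ℕ → A × C → ℝ≥0∞} {e : ℕ → Z × C → ℝ≥0∞} [DiscreteMeasurableSpace Z]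
    (h : ∀ n, IsSectionCondExp J (g n) (e n)) (hg : ∀ n, Measurable (g n)) :
    IsSectionCondExp J (fun p ↦ ∑' n, g n p) (fun p ↦ ∑' n, e n p) where
  measurable := Measurable.tsum fun n ↦ (h n).measurable
  setLIntegral_eq s B := by
    have hs : Measurable s := .of_discrete
    rw [lintegral_tsum (fun n ↦ by exact Measurable.of_discrete.aemeasurable),
      lintegral_tsum (fun n ↦ by have := hg n; fun_prop)]
    simp_rw [(h _).setLIntegral_eq]

/-- Sectionwise conditional expectations are unique up to a null set of the middle space. -/
theorem ae_eq [DiscreteMeasurableSpace Z] [IsFiniteMeasure J] {g : A × C → ℝ≥0∞}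
    {e e' : Z × C → ℝ≥0∞} (h : IsSectionCondExp J g e) (h' : IsSectionCondExp J g e') :
    ∀ᵐ z ∂(J.map Prod.snd), ∀ c, e (z, c) = e' (z, c) := by
  rcases isEmpty_or_nonempty C with hC | hC
  · exact .of_forall fun z c ↦ hC.elim c
  have hsel : ∀ z, ∃ c, (∃ c', e (z, c') ≠ e' (z, c')) → e (z, c) ≠ e' (z, c) := by
    intro z
    by_cases hz : ∃ c', e (z, c') ≠ e' (z, c')
    · exact hz.imp fun c hc _ ↦ hc
    · exact ⟨hC.some, fun hz' ↦ absurd hz' hz⟩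
  choose s hs using hsel
  have hae : (fun z ↦ e (z, s z)) =ᵐ[J.map Prod.snd] fun z ↦ e' (z, s z) :=
    ae_eq_of_forall_setLIntegral_eq_of_sigmaFinite .of_discrete .of_discrete fun B _ _ ↦ by
      rw [h.setLIntegral_eq, h'.setLIntegral_eq]
  filter_upwards [hae] with z hz c
  by_contra hne
  exact hs z ⟨c, hne⟩ hz

theorem lintegral_congr [DiscreteMeasurableSpace Z] [IsFiniteMeasure J] {g : A × C → ℝ≥0∞}
    {e e' : Z × C → ℝ≥0∞} (h : IsSectionCondExp J g e) (h' : IsSectionCondExp J g e')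
    {P : Measure (Z × C)} (hP : J.map Prod.snd = P.map Prod.fst) :
    ∫⁻ p, e p ∂P = ∫⁻ p, e' p ∂P := by
  refine lintegral_congr_ae ?_
  have := h.ae_eq h'
  rw [hP] at this
  filter_upwards [ae_of_ae_map measurable_fst.aemeasurable this] with p hp using hp p.2

end IsSectionCondExp

variable [DiscreteMeasurableSpace Z]

theorem isSectionCondExp_prod (J : Measure (A × Z)) [IsFiniteMeasure J] {S : Set A} {T : Set C}
    (hS : MeasurableSet S) (hT : MeasurableSet T) :
    IsSectionCondExp J ((S ×ˢ T).indicator 1) fun p ↦ T.indicator 1 p.2 *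
      ((J.restrict (Prod.fst ⁻¹' S)).map Prod.snd).rnDeriv (J.map Prod.snd) p.1 where
  measurable := by
    have := Measure.measurable_rnDeriv ((J.restrict (Prod.fst ⁻¹' S)).map Prod.snd)
      (J.map Prod.snd)
    have := (measurable_one (α := ℝ≥0∞) (β := C)).indicator hT
    fun_prop
  setLIntegral_eq s B := by
    have hac : (J.restrict (Prod.fst ⁻¹' S)).map Prod.snd ≪ J.map Prod.snd :=
      Measure.absolutelyContinuous_of_le (Measure.map_mono Measure.restrict_le_self measurable_snd)
    have hs : Measurable s := .of_discrete
    have e₁ : ∀ z, T.indicator (1 : C → ℝ≥0∞) (s z) *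
        ((J.restrict (Prod.fst ⁻¹' S)).map Prod.snd).rnDeriv (J.map Prod.snd) z =
        (s ⁻¹' T).indicator
          (((J.restrict (Prod.fst ⁻¹' S)).map Prod.snd).rnDeriv (J.map Prod.snd)) z := by
      intro z
      by_cases hz : s z ∈ T <;> simp [hz]
    have e₂ : ∀ p : A × Z, (S ×ˢ T).indicator (1 : A × C → ℝ≥0∞) (p.1, s p.2) =
        (Prod.fst ⁻¹' S ∩ Prod.snd ⁻¹' (s ⁻¹' T)).indicator 1 p := by
      intro p
      by_cases hp : p.1 ∈ S <;> by_cases hp' : s p.2 ∈ T <;> simp [hp, hp']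
    simp_rw [e₁, e₂]
    rw [lintegral_indicator (hs hT), Measure.restrict_restrict (hs hT),
      Measure.setLIntegral_rnDeriv hac, lintegral_indicator_one
        ((measurable_fst hS).inter (measurable_snd (hs hT))),
      Measure.map_apply measurable_snd .of_discrete,
      Measure.restrict_apply (measurable_snd .of_discrete),
      Measure.restrict_apply ((measurable_fst hS).inter (measurable_snd (hs hT)))]
    congr 1
    ext p
    simp only [mem_inter_iff, mem_preimage]
    tauto

theorem IsSectionCondExp.compl {J : Measure (A × Z)} [IsFiniteMeasure J] {F : Set (A × C)}
    (hF : MeasurableSet F) {e : Z × C → ℝ≥0∞} (h : IsSectionCondExp J (F.indicator 1) e) :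
    IsSectionCondExp J (Fᶜ.indicator 1) (1 - e) where
  measurable := measurable_one.sub h.measurable
  setLIntegral_eq s B := by
    have hs : Measurable s := .of_discrete
    have hB : MeasurableSet B := .of_discrete
    have hle : (fun z ↦ e (z, s z)) ≤ᵐ[J.map Prod.snd] 1 :=
      ae_le_of_forall_setLIntegral_le_of_sigmaFinite .of_discrete fun B _ _ ↦ by
        rw [h.setLIntegral_eq]
        simp only [Pi.one_apply]
        rw [setLIntegral_one, Measure.map_apply measurable_snd .of_discrete, ← setLIntegral_one]
        exact lintegral_mono fun p ↦ indicator_le_self' (by simp) _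
    have hfin : ∫⁻ z in B, e (z, s z) ∂(J.map Prod.snd) ≠ ∞ := by
      refine ((lintegral_mono_ae (ae_restrict_of_ae hle)).trans_lt ?_).ne
      simp
    have hF' : Measurable fun p : A × Z ↦ F.indicator (1 : A × C → ℝ≥0∞) (p.1, s p.2) :=
      (measurable_one.indicator hF).comp (by fun_prop)
    have e₁ : ∀ p : A × Z, Fᶜ.indicator (1 : A × C → ℝ≥0∞) (p.1, s p.2) =
        1 - F.indicator (1 : A × C → ℝ≥0∞) (p.1, s p.2) := by
      intro p
      by_cases hp : (p.1, s p.2) ∈ F <;> simp [hp]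
    simp_rw [e₁, Pi.sub_apply, Pi.one_apply]
    rw [lintegral_sub (f := fun _ ↦ 1) (g := fun z ↦ e (z, s z)) .of_discrete hfin
        (ae_restrict_of_ae hle),
      lintegral_sub (f := fun _ ↦ 1) hF' (by rwa [← h.setLIntegral_eq])
        (.of_forall fun p ↦ indicator_le_self' (by simp) _),
      h.setLIntegral_eq, setLIntegral_one, setLIntegral_one,
      Measure.map_apply measurable_snd hB]

theorem tsum_indicator_one_eq {β : Type*} {f : ℕ → Set β}
    (hd : Pairwise (Function.onFun Disjoint f)) :
    (⋃ n, f n).indicator (1 : β → ℝ≥0∞) = fun p ↦ ∑' n, (f n).indicator 1 p := by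
  ext p
  by_cases hp : ∃ n, p ∈ f n
  · obtain ⟨n, hn⟩ := hp
    rw [tsum_eq_single n, indicator_of_mem hn, indicator_of_mem (mem_iUnion_of_mem n hn)]
    intro m hm
    exact indicator_of_notMem (fun hm' ↦ (hd hm).notMem_of_mem_left hm' hn) _
  · push Not at hp
    simp [hp]

theorem exists_isSectionCondExp_indicator (J : Measure (A × Z)) [IsFiniteMeasure J]
    {F : Set (A × C)} (hF : MeasurableSet F) : ∃ e, IsSectionCondExp J (F.indicator 1) e := by
  induction F, hF using MeasurableSpace.induction_on_inter generateFrom_prod.symm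
    isPiSystem_prod with
  | empty => exact ⟨_, by simpa using isSectionCondExp_prod J .empty (.empty (α := C))⟩
  | basic F hF =>
    obtain ⟨S, hS, T, hT, rfl⟩ := hF
    exact ⟨_, isSectionCondExp_prod J hS hT⟩
  | compl F hF ih =>
    obtain ⟨e, he⟩ := ih
    exact ⟨_, he.compl hF⟩
  | iUnion f hd hf ih =>
    choose e he using ih
    rw [tsum_indicator_one_eq hd]
    exact ⟨_, .tsum he fun n ↦ measurable_one.indicator (hf n)⟩

/-- Gluing of two finite measures along a middle space all of whose subsets are measurable. The
integral of a simple function against the glued measure is the integral of its sectionwise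
conditional expectation. -/
theorem exists_glued_measure (J : Measure (A × Z)) [IsFiniteMeasure J] (P : Measure (Z × C))
    (hP : J.map Prod.snd = P.map Prod.fst) :
    ∃ K : Measure (A × C), ∀ g : SimpleFunc (A × C) ℝ≥0∞,
      ∃ e, IsSectionCondExp J g e ∧ ∫⁻ p, g p ∂K = ∫⁻ p, e p ∂P := by
  have hex := fun F (hF : MeasurableSet F) ↦ exists_isSectionCondExp_indicator (C := C) J hF
  choose e he using hex
  let K : Measure (A × C) := Measure.ofMeasurable (fun F hF ↦ ∫⁻ p, e F hF p ∂P)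
    (by
      have h₀ : IsSectionCondExp J ((∅ : Set (A × C)).indicator 1) 0 :=
        ⟨measurable_zero, by simp⟩
      rw [(he ∅ .empty).lintegral_congr h₀ hP]
      simp)
    (by
      intro f hf hd
      have hsum : IsSectionCondExp J ((⋃ n, f n).indicator 1)
          (fun p ↦ ∑' n, e (f n) (hf n) p) := by
        rw [tsum_indicator_one_eq hd]
        exact .tsum (fun n ↦ he _ _) fun n ↦ measurable_one.indicator (hf n)
      rw [(he _ _).lintegral_congr hsum hP,
        lintegral_tsum fun n ↦ (he _ (hf n)).measurable.aemeasurable])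
  refine ⟨K, fun g ↦ ?_⟩
  induction g using SimpleFunc.induction with
  | const r hF =>
    rename_i F
    have hind : (fun p ↦ r * F.indicator (1 : A × C → ℝ≥0∞) p) = F.indicator fun _ ↦ r := by
      ext p
      by_cases hp : p ∈ F <;> simp [hp]
    refine ⟨fun p ↦ r * e F hF p, ?_, ?_⟩
    · have := (he F hF).const_mul (measurable_one.indicator hF) r
      rw [hind] at this
      convert this using 1
      ext p
      by_cases hp : p ∈ F <;> simp [hp]
    · have hKF : K F = ∫⁻ p, e F hF p ∂P := Measure.ofMeasurable_apply F hF
      have : ∀ p, (SimpleFunc.piecewise F hF (SimpleFunc.const _ r) (SimpleFunc.const _ 0)) p =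
          F.indicator (fun _ ↦ r) p := by
        intro p
        by_cases hp : p ∈ F <;> simp [hp]
      simp_rw [this]
      rw [lintegral_const_mul _ (he F hF).measurable, lintegral_indicator_const hF, hKF]
  | add _ ih₁ ih₂ =>
    rename_i f g _
    obtain ⟨e₁, he₁, hi₁⟩ := ih₁
    obtain ⟨e₂, he₂, hi₂⟩ := ih₂
    refine ⟨e₁ + e₂, by simpa using he₁.add he₂ f.measurable, ?_⟩
    simp only [SimpleFunc.coe_add, Pi.add_apply]
    rw [lintegral_add_left f.measurable, lintegral_add_left he₁.measurable, hi₁, hi₂]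

theorem lintegral_sub_le_of_isSectionCondExp {J : Measure (A × Z)} [IsFiniteMeasure J]
    {g : A × C → ℝ≥0∞} {e : Z × C → ℝ≥0∞} (he : IsSectionCondExp J g e)
    {c₁ : A × Z → ℝ≥0∞} {u : Z → ℝ≥0∞} (hu : ∀ z, u z ≠ ∞) (s : Z → C)
    (hg : ∀ a z, g (a, s z) ≤ c₁ (a, z) + u z) :
    ∫⁻ z, (e (z, s z) - u z) ∂(J.map Prod.snd) ≤ ∫⁻ p, c₁ p ∂J := by
  have hlevel : ∀ n : ℕ, ∫⁻ z in {z | u z ≤ n}, (e (z, s z) - u z) ∂(J.map Prod.snd) ≤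
      ∫⁻ p, c₁ p ∂J := by
    intro n
    set B : Set Z := {z | u z ≤ n ∧ u z ≤ e (z, s z)}
    have hB : MeasurableSet B := .of_discrete
    have hzero : ∫⁻ z in {z | u z ≤ n}, (e (z, s z) - u z) ∂(J.map Prod.snd) =
        ∫⁻ z in B, (e (z, s z) - u z) ∂(J.map Prod.snd) := by
      rw [← lintegral_indicator .of_discrete, ← lintegral_indicator hB]
      congr 1 with z
      by_cases h₁ : u z ≤ n <;> by_cases h₂ : u z ≤ e (z, s z)
      · simp [B, h₁, h₂]
      · simp [B, h₁, h₂, tsub_eq_zero_of_le (le_of_not_ge h₂)]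
      · simp [B, h₁]
      · simp [B, h₁]
    have hfin : ∫⁻ z in B, u z ∂(J.map Prod.snd) ≠ ∞ := by
      refine ((setLIntegral_mono .of_discrete fun z hz ↦ hz.1 :
        _ ≤ ∫⁻ z in B, (n : ℝ≥0∞) ∂(J.map Prod.snd)).trans_lt ?_).ne
      rw [setLIntegral_const]
      exact ENNReal.mul_lt_top (by simp) (measure_lt_top _ _)
    rw [hzero, lintegral_sub .of_discrete hfin
      (ae_restrict_of_forall_mem hB fun z hz ↦ hz.2), he.setLIntegral_eq, tsub_le_iff_right]
    calc ∫⁻ p in Prod.snd ⁻¹' B, g (p.1, s p.2) ∂J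
        ≤ ∫⁻ p in Prod.snd ⁻¹' B, (c₁ p + u p.2) ∂J := lintegral_mono fun p ↦ hg p.1 p.2
      _ = ∫⁻ p in Prod.snd ⁻¹' B, c₁ p ∂J + ∫⁻ p in Prod.snd ⁻¹' B, u p.2 ∂J :=
          lintegral_add_right _ (Measurable.comp .of_discrete measurable_snd)
      _ ≤ ∫⁻ p, c₁ p ∂J + ∫⁻ z in B, u z ∂(J.map Prod.snd) := by
          rw [setLIntegral_map hB .of_discrete measurable_snd]
          exact add_le_add_left (setLIntegral_le_lintegral _ _) _
  have huniv : ⋃ n : ℕ, {z | u z ≤ n} = univ := by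
    refine eq_univ_of_forall fun z ↦ mem_iUnion.2 ?_
    obtain ⟨n, hn⟩ := ENNReal.exists_nat_gt (hu z)
    exact ⟨n, hn.le⟩
  have hmono : Monotone fun n : ℕ ↦ {z | u z ≤ n} := fun m n hmn z hz ↦
    le_trans (show u z ≤ m from hz) (by exact_mod_cast hmn)
  rw [← setLIntegral_univ, ← huniv, setLIntegral_iUnion_of_directed _ hmono.directed_le]
  exact iSup_le hlevel

/-- Gluing two finite measures along a middle space all of whose subsets are measurable does not
increase the (lower) transport cost. No measurability of the costs is required. -/
theorem exists_glue (J : Measure (A × Z)) [IsFiniteMeasure J] (P : Measure (Z × C))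
    (hP : J.map Prod.snd = P.map Prod.fst) {c : A × C → ℝ≥0∞} {c₁ : A × Z → ℝ≥0∞}
    {c₂ : Z × C → ℝ≥0∞} (hc₂ : ∀ p, c₂ p ≠ ∞) (hc : ∀ a z y, c (a, y) ≤ c₁ (a, z) + c₂ (z, y)) :
    ∃ K : Measure (A × C), K.map Prod.fst = J.map Prod.fst ∧ K.map Prod.snd = P.map Prod.snd ∧
      ∫⁻ p, c p ∂K ≤ ∫⁻ p, c₁ p ∂J + ∫⁻ p, c₂ p ∂P := by
  obtain ⟨K, hK⟩ := exists_glued_measure J P hP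
  have hprod : ∀ {S : Set A} {T : Set C}, MeasurableSet S → MeasurableSet T →
      K (S ×ˢ T) = ∫⁻ p, T.indicator 1 p.2 *
        ((J.restrict (Prod.fst ⁻¹' S)).map Prod.snd).rnDeriv (J.map Prod.snd) p.1 ∂P := by
    intro S T hS hT
    obtain ⟨e, he, hi⟩ := hK (SimpleFunc.piecewise (S ×ˢ T) (hS.prod hT) 1 0)
    have hfun : ⇑(SimpleFunc.piecewise (S ×ˢ T) (hS.prod hT) (1 : SimpleFunc (A × C) ℝ≥0∞) 0) =
        (S ×ˢ T).indicator 1 := by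
      ext p
      by_cases hp : p ∈ S ×ˢ T <;> simp [-mem_prod, hp]
    rw [hfun] at he hi
    rw [← he.lintegral_congr (isSectionCondExp_prod J hS hT) hP, ← hi,
      lintegral_indicator_one (hS.prod hT)]
  refine ⟨K, ?_, ?_, ?_⟩
  · ext S hS
    have hac : (J.restrict (Prod.fst ⁻¹' S)).map Prod.snd ≪ J.map Prod.snd :=
      Measure.absolutelyContinuous_of_le (Measure.map_mono Measure.restrict_le_self measurable_snd)
    rw [Measure.map_apply measurable_fst hS, ← prod_univ, hprod hS .univ]
    simp only [indicator_univ, Pi.one_apply, one_mul]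
    rw [← lintegral_map (Measure.measurable_rnDeriv _ _) measurable_fst, ← hP,
      Measure.lintegral_rnDeriv hac, Measure.map_apply measurable_snd .univ,
      Measure.map_apply measurable_fst hS]
    simp
  · ext T hT
    have hone : (J.map Prod.snd).rnDeriv (J.map Prod.snd) =ᵐ[P.map Prod.fst] 1 := by
      rw [← hP]
      exact Measure.rnDeriv_self _
    rw [Measure.map_apply measurable_snd hT, ← univ_prod, hprod .univ hT,
      Measure.map_apply measurable_snd hT, ← lintegral_indicator_one (measurable_snd hT)]
    refine lintegral_congr_ae ?_
    filter_upwards [ae_of_ae_map measurable_fst.aemeasurable hone] with p hp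
    rw [preimage_univ, Measure.restrict_univ, hp, Pi.one_apply, mul_one]
    rfl
  rw [lintegral]
  refine iSup₂_le fun g hg ↦ ?_
  obtain ⟨e, he, hi⟩ := hK g
  rw [← SimpleFunc.lintegral_eq_lintegral, hi]
  rcases isEmpty_or_nonempty C with hC | hC
  · have : IsEmpty (Z × C) := inferInstance
    simp [Measure.eq_zero_of_isEmpty P]
  let φ : Z → ℝ≥0∞ := fun z ↦ ⨆ y, (e (z, y) - c₂ (z, y))
  have hseq : ∀ z, ∃ s : ℕ → C, Monotone (fun n ↦ e (z, s n) - c₂ (z, s n)) ∧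
      ⨆ n, (e (z, s n) - c₂ (z, s n)) = φ z := by
    intro z
    obtain ⟨u, hmono, hlim, hmem⟩ := exists_seq_tendsto_sSup
      (range_nonempty fun y ↦ e (z, y) - c₂ (z, y)) (OrderTop.bddAbove _)
    choose s hs using hmem
    obtain rfl : (fun n ↦ e (z, s n) - c₂ (z, s n)) = u := funext hs
    exact ⟨s, hmono, iSup_eq_of_tendsto hmono hlim⟩
  choose s hmono hsup using hseq
  have hφ : ∫⁻ z, φ z ∂(J.map Prod.snd) ≤ ∫⁻ p, c₁ p ∂J := by
    simp_rw [← hsup]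
    rw [lintegral_iSup (fun n ↦ .of_discrete) fun m n hmn z ↦ hmono z hmn]
    exact iSup_le fun n ↦ lintegral_sub_le_of_isSectionCondExp he (fun z ↦ hc₂ _)
      (fun z ↦ s z n) fun a z ↦ (hg _).trans (hc _ _ _)
  calc ∫⁻ p, e p ∂P ≤ ∫⁻ p, (φ p.1 + c₂ p) ∂P :=
        lintegral_mono fun p ↦ tsub_le_iff_right.1 (le_iSup (fun y ↦ e (p.1, y) - c₂ (p.1, y)) p.2)
    _ = ∫⁻ p, φ p.1 ∂P + ∫⁻ p, c₂ p ∂P :=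
        lintegral_add_left (f := fun p : Z × C ↦ φ p.1)
          (Measurable.comp (g := φ) .of_discrete measurable_fst) _
    _ ≤ ∫⁻ p, c₁ p ∂J + ∫⁻ p, c₂ p ∂P := by
        rw [← lintegral_map (f := φ) .of_discrete measurable_fst, ← hP]
        gcongr

end Gluing

section Rerouting

variable {A Z : Type*} [MeasurableSpace A] [MeasurableSpace Z]

theorem map_fst_univ {B : Type*} [MeasurableSpace B] (μ : Measure (A × B)) :
    μ.map Prod.fst univ = μ univ := by
  rw [Measure.map_apply measurable_fst .univ, preimage_univ]

theorem map_snd_univ {B : Type*} [MeasurableSpace B] (μ : Measure (A × B)) :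
    μ.map Prod.snd univ = μ univ := by
  rw [Measure.map_apply measurable_snd .univ, preimage_univ]

/-- A stage of the rerouting procedure: mass `transit` is on its way from `A` and has currently
reached `Z`, and the part `plan` of the transport plan, which has not been used so far, moves the
mass in transit together with `reserve` onto `reserve` and `demand`. -/
structure RoutingState (A Z : Type*) [MeasurableSpace A] [MeasurableSpace Z] where
  transit : Measure (A × Z)
  plan : Measure (Z × Z)
  reserve : Measure Z
  demand : Measure Z
  [isFiniteMeasure_transit : IsFiniteMeasure transit]
  [isFiniteMeasure_plan : IsFiniteMeasure plan]
  map_fst_plan : plan.map Prod.fst = transit.map Prod.snd + reserve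
  map_snd_plan : plan.map Prod.snd = reserve + demand

namespace RoutingState

attribute [instance] isFiniteMeasure_transit isFiniteMeasure_plan

instance (s : RoutingState A Z) : IsFiniteMeasure s.reserve :=
  isFiniteMeasure_of_le (s.plan.map Prod.snd) (s.map_snd_plan ▸ Measure.le_add_right le_rfl)

instance (s : RoutingState A Z) : IsFiniteMeasure s.demand :=
  isFiniteMeasure_of_le (s.plan.map Prod.snd) (s.map_snd_plan ▸ Measure.le_add_left le_rfl)

/-- The cost already incurred by the mass in transit plus the cost of the unused plan. -/
noncomputable def cost (s : RoutingState A Z) (c : A × Z → ℝ≥0∞) (d : Z × Z → ℝ≥0∞) : ℝ≥0∞ :=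
  ∫⁻ p, c p ∂s.transit + ∫⁻ p, d p ∂s.plan

/-- Move the mass in transit along the plan; the part `Q` of it which meets the demand stops. -/
theorem exists_next [DiscreteMeasurableSpace Z] {c : A × Z → ℝ≥0∞} {d : Z × Z → ℝ≥0∞}
    (hd : ∀ p, d p ≠ ∞) (hcd : ∀ a z y, c (a, y) ≤ c (a, z) + d (z, y)) (s : RoutingState A Z) :
    ∃ (Q : Measure (A × Z)) (s' : RoutingState A Z),
      Q.map Prod.fst + s'.transit.map Prod.fst = s.transit.map Prod.fst ∧
      Q.map Prod.snd + s'.demand = s.demand ∧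
      ∫⁻ p, c p ∂Q + s'.cost c d ≤ s.cost c d ∧
      s.transit univ + s'.plan univ = s.plan univ := by
  obtain ⟨π₁, π₂, hπ, hπ₁, hπ₂⟩ :=
    exists_add_of_map_eq_add s.plan measurable_fst _ _ s.map_fst_plan
  obtain ⟨K, hK₁, hK₂, hKc⟩ := exists_glue s.transit π₁ hπ₁.symm hd hcd
  have hsplit : π₁.map Prod.snd + π₂.map Prod.snd = s.reserve + s.demand := by
    rw [← s.map_snd_plan, ← hπ, Measure.map_add _ _ measurable_snd]
  obtain ⟨ρ₁₁, ρ₁₂, ρ₂₁, ρ₂₂, h₁, h₂, hr, hd⟩ := exists_common_refinement _ _ _ _ hsplit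
  have : IsFiniteMeasure ρ₁₁ := isFiniteMeasure_of_le s.reserve (hr ▸ Measure.le_add_right le_rfl)
  have : IsFiniteMeasure ρ₁₂ := isFiniteMeasure_of_le s.demand (hd ▸ Measure.le_add_right le_rfl)
  obtain ⟨K₁, K₂, hK, hρ₁₁, hρ₁₂⟩ :=
    exists_add_of_map_eq_add K measurable_snd ρ₁₁ ρ₁₂ (hK₂.trans h₁.symm)
  have : IsFiniteMeasure K₁ := ⟨by rw [← map_snd_univ, hρ₁₁]; exact measure_lt_top _ _⟩
  have : IsFiniteMeasure π₂ := isFiniteMeasure_of_le s.plan (hπ ▸ Measure.le_add_left le_rfl)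
  refine ⟨K₂, ⟨K₁, π₂, ρ₂₁, ρ₂₂, by rw [hπ₂, hρ₁₁, hr], h₂.symm⟩, ?_, by rw [hρ₁₂, hd], ?_, ?_⟩
  · rw [← hK₁, ← hK, Measure.map_add _ _ measurable_fst, add_comm]
  · rw [← hK, lintegral_add_measure] at hKc
    simp only [cost]
    calc ∫⁻ p, c p ∂K₂ + (∫⁻ p, c p ∂K₁ + ∫⁻ p, d p ∂π₂)
        = (∫⁻ p, c p ∂K₁ + ∫⁻ p, c p ∂K₂) + ∫⁻ p, d p ∂π₂ := by ring
      _ ≤ (∫⁻ p, c p ∂s.transit + ∫⁻ p, d p ∂π₁) + ∫⁻ p, d p ∂π₂ := by gcongr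
      _ = ∫⁻ p, c p ∂s.transit + ∫⁻ p, d p ∂s.plan := by
        rw [← hπ, lintegral_add_measure, add_assoc]
  · rw [← hπ, Measure.add_apply, ← map_snd_univ s.transit, ← hπ₁, map_fst_univ]

/-- Iterating `exists_next`, the mass in transit can be moved onto the demand. -/
theorem exists_coupling [DiscreteMeasurableSpace Z] {c : A × Z → ℝ≥0∞} {d : Z × Z → ℝ≥0∞}
    (hd : ∀ p, d p ≠ ∞) (hcd : ∀ a z y, c (a, y) ≤ c (a, z) + d (z, y)) (s : RoutingState A Z)
    (hs : s.transit univ = s.demand univ) :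
    ∃ Q : Measure (A × Z), Q.map Prod.fst = s.transit.map Prod.fst ∧
      Q.map Prod.snd = s.demand ∧ ∫⁻ p, c p ∂Q ≤ s.cost c d := by
  choose Q next hfst hsnd hcost hmass using exists_next (A := A) hd hcd
  let t : ℕ → RoutingState A Z := fun n ↦ next^[n] s
  have ht : ∀ n, t (n + 1) = next (t n) := fun n ↦ Function.iterate_succ_apply' next n s
  have hfst' : ∀ n, ∑ k ∈ Finset.range n, (Q (t k)).map Prod.fst + (t n).transit.map Prod.fst =
      s.transit.map Prod.fst := by
    intro n
    induction n with
    | zero => simp [t]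
    | succ n ih => rw [Finset.sum_range_succ, add_assoc, ht, hfst, ih]
  have hsnd' : ∀ n, ∑ k ∈ Finset.range n, (Q (t k)).map Prod.snd + (t n).demand = s.demand := by
    intro n
    induction n with
    | zero => simp [t]
    | succ n ih => rw [Finset.sum_range_succ, add_assoc, ht, hsnd, ih]
  have hcost' : ∀ n, ∑ k ∈ Finset.range n, ∫⁻ p, c p ∂(Q (t k)) + (t n).cost c d ≤
      s.cost c d := by
    intro n
    induction n with
    | zero => simp [t]
    | succ n ih =>
      rw [Finset.sum_range_succ, add_assoc, ht]
      exact (add_le_add_right (hcost _) _).trans ih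
  have hmass' : ∀ n, ∑ k ∈ Finset.range n, (t k).transit univ + (t n).plan univ =
      s.plan univ := by
    intro n
    induction n with
    | zero => simp [t]
    | succ n ih => rw [Finset.sum_range_succ, add_assoc, ht, hmass, ih]
  have hlim : Tendsto (fun n ↦ (t n).transit univ) atTop (nhds 0) := by
    refine ENNReal.tendsto_atTop_zero_of_tsum_ne_top (ne_top_of_le_ne_top
      (measure_ne_top s.plan univ) ?_)
    rw [ENNReal.tsum_eq_iSup_nat]
    exact iSup_le fun n ↦ (hmass' n) ▸ le_self_add
  let R : Measure (A × Z) := Measure.sum fun n ↦ Q (t n)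
  have hR₁ : R.map Prod.fst = s.transit.map Prod.fst := by
    ext S hS
    have hlimS : Tendsto (fun n ↦ (t n).transit.map Prod.fst S) atTop (nhds 0) :=
      tendsto_of_tendsto_of_tendsto_of_le_of_le tendsto_const_nhds hlim (fun n ↦ zero_le)
        fun n ↦ (measure_mono (subset_univ S)).trans (map_fst_univ _).le
    have hsum : Tendsto (fun n ↦ ∑ k ∈ Finset.range n, (Q (t k)).map Prod.fst S) atTop
        (nhds (R.map Prod.fst S)) := by
      rw [Measure.map_sum measurable_fst.aemeasurable, Measure.sum_apply _ hS]
      exact ENNReal.tendsto_nat_tsum _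
    have hadd := hsum.add hlimS
    rw [add_zero] at hadd
    refine tendsto_nhds_unique hadd (tendsto_const_nhds.congr fun n ↦ ?_)
    rw [← hfst' n]
    simp
  have hR₂ : R.map Prod.snd ≤ s.demand := by
    refine Measure.le_iff.2 fun S hS ↦ ?_
    rw [Measure.map_sum measurable_snd.aemeasurable, Measure.sum_apply _ hS,
      ENNReal.tsum_eq_iSup_nat]
    refine iSup_le fun n ↦ ?_
    rw [← hsnd' n]
    simp
  refine ⟨R, hR₁, ?_, ?_⟩
  · have : IsFiniteMeasure (R.map Prod.snd) := isFiniteMeasure_of_le _ hR₂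
    refine Measure.eq_of_le_of_measure_univ_eq hR₂ ?_
    rw [map_snd_univ, ← map_fst_univ, hR₁, map_fst_univ, hs]
  · rw [lintegral_sum_measure, ENNReal.tsum_eq_iSup_nat]
    exact iSup_le fun n ↦ le_self_add.trans (hcost' n)

end RoutingState

end Rerouting

section Discretization

/-- A metric space admits maps which are arbitrarily close to the identity and pull back arbitrary
sets to Borel sets. No separability is needed. -/
theorem exists_dist_lt_forall_measurableSet_preimage (X : Type*) [MetricSpace X]
    [MeasurableSpace X] [BorelSpace X] {ε : ℝ} (hε : 0 < ε) :
    ∃ D : X → X, (∀ x, dist x (D x) < ε) ∧ ∀ S : Set X, MeasurableSet (D ⁻¹' S) := by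
  obtain ⟨v, hvo, hvu, hvf, hvb⟩ := precise_refinement (fun x : X ↦ Metric.ball x ε)
    (fun _ ↦ Metric.isOpen_ball) (eq_univ_of_forall fun x ↦ mem_iUnion_of_mem x
      (Metric.mem_ball_self hε))
  obtain ⟨_, hwo⟩ := exists_wellFoundedLT X
  have hne : ∀ x, {y | x ∈ v y}.Nonempty := fun x ↦ mem_iUnion.1 (hvu ▸ mem_univ x)
  let D : X → X := fun x ↦ wellFounded_lt.min {y | x ∈ v y} (hne x)
  have hD : ∀ x, x ∈ v (D x) := fun x ↦ wellFounded_lt.min_mem _ (hne x)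
  choose F hFc _ hFu _ using fun y ↦ (hvo y).exists_iUnion_isClosed
  have hfiber : ∀ y, D ⁻¹' {y} = ⋃ n, F y n ∩ (⋃ z < y, v z)ᶜ := by
    intro y
    rw [← iUnion_inter, hFu]
    ext x
    simp only [mem_preimage, mem_singleton_iff, mem_inter_iff, mem_compl_iff, mem_iUnion,
      not_exists]
    constructor
    · rintro rfl
      exact ⟨hD x, fun z hz hxz ↦ wellFounded_lt.not_lt_min {y | x ∈ v y} hxz hz⟩
    · rintro ⟨hxy, hmin⟩
      refine le_antisymm ?_ (not_lt.1 fun h ↦ hmin _ h (hD x))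
      exact not_lt.1 (wellFounded_lt.not_lt_min {y | x ∈ v y} hxy)
  refine ⟨D, fun x ↦ hvb _ (hD x), fun S ↦ ?_⟩
  have hS : D ⁻¹' S = ⋃ n, ⋃ y : S, F y n ∩ (⋃ z < (y : X), v z)ᶜ := by
    rw [iUnion_comm, ← biUnion_preimage_singleton, biUnion_eq_iUnion]
    simp_rw [hfiber]
  rw [hS]
  refine .iUnion fun n ↦ (LocallyFinite.isClosed_iUnion ?_ fun y ↦ ?_).measurableSet
  · refine (hvf.comp_injective Subtype.val_injective).subset fun y ↦ ?_
    exact inter_subset_left.trans ((subset_iUnion _ n).trans (hFu y).subset)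
  · exact (hFc _ n).inter (isOpen_biUnion fun z _ ↦ hvo z).isClosed_compl

end Discretization

/-- Rerouting a coupling of `α + β` and `α + γ` through an `ε`-discretization `D` of the space
yields a coupling of `β` and `γ` which is at most `O(ε)` more expensive. -/
theorem wassersteinDist_le_of_discretization {X Z : Type*} [PseudoMetricSpace X]
    [MeasurableSpace X] [MeasurableSpace Z] [DiscreteMeasurableSpace Z] {D : X → Z}
    (hD : Measurable D) (ι : Z → X) {ε : ℝ} (hε : ∀ x, dist x (ι (D x)) ≤ ε) {α β γ : Measure X}
    [IsFiniteMeasure α] [IsFiniteMeasure β] [IsFiniteMeasure γ] (hmass : β univ = γ univ)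
    {π : Measure (X × X)} (hπ₁ : π.map Prod.fst = α + β) (hπ₂ : π.map Prod.snd = α + γ) :
    wassersteinDist β γ ≤ ∫⁻ p, ENNReal.ofReal (dist p.1 p.2) ∂π +
      ENNReal.ofReal ε * (β univ + 2 * π univ + γ univ) := by
  have htri : ∀ x y z : X, ENNReal.ofReal (dist x z) ≤
      ENNReal.ofReal (dist x y) + ENNReal.ofReal (dist y z) := fun x y z ↦ by
    rw [← ENNReal.ofReal_add dist_nonneg dist_nonneg]
    exact ENNReal.ofReal_le_ofReal (dist_triangle _ _ _)
  have hεD : ∀ x, ENNReal.ofReal (dist x (ι (D x))) ≤ ENNReal.ofReal ε := fun x ↦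
    ENNReal.ofReal_le_ofReal (hε x)
  have : IsFiniteMeasure π := ⟨by rw [← map_fst_univ, hπ₁]; exact measure_lt_top _ _⟩
  have hgraph : Measurable fun x ↦ (x, D x) := measurable_id.prodMk hD
  have hgraph' : Measurable fun x ↦ (D x, x) := hD.prodMk measurable_id
  have hDD : Measurable (Prod.map D D) := hD.prodMap hD
  have hβ : (β.map fun x ↦ (x, D x)).map Prod.fst = β := by
    rw [Measure.map_map measurable_fst hgraph]
    exact Measure.map_id
  have hγ : (γ.map fun x ↦ (D x, x)).map Prod.snd = γ := by
    rw [Measure.map_map measurable_snd hgraph']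
    exact Measure.map_id
  let s : RoutingState X Z :=
    { transit := β.map fun x ↦ (x, D x)
      plan := π.map (Prod.map D D)
      reserve := α.map D
      demand := γ.map D
      map_fst_plan := by
        rw [Measure.map_map measurable_snd hgraph, Measure.map_map measurable_fst hDD]
        change π.map (D ∘ Prod.fst) = β.map D + _
        rw [← Measure.map_map hD measurable_fst, hπ₁, Measure.map_add _ _ hD, add_comm]
      map_snd_plan := by
        rw [Measure.map_map measurable_snd hDD]
        change π.map (D ∘ Prod.snd) = _
        rw [← Measure.map_map hD measurable_snd, hπ₂, Measure.map_add _ _ hD] }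
  have hs : s.transit univ = s.demand univ := by
    simp only [s, Measure.map_apply hgraph .univ, Measure.map_apply hD .univ, preimage_univ, hmass]
  obtain ⟨Q, hQ₁, hQ₂, hQc⟩ := s.exists_coupling
    (c := fun p ↦ ENNReal.ofReal (dist p.1 (ι p.2)))
    (d := fun p ↦ ENNReal.ofReal (dist (ι p.1) (ι p.2)))
    (fun _ ↦ ENNReal.ofReal_ne_top) (fun _ _ _ ↦ htri _ _ _) hs
  have : IsFiniteMeasure Q := ⟨by rw [← map_fst_univ, hQ₁]; exact measure_lt_top _ _⟩
  have hQP : Q.map Prod.snd = (γ.map fun x ↦ (D x, x)).map Prod.fst := by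
    rw [hQ₂, Measure.map_map measurable_fst hgraph']
    rfl
  obtain ⟨K, hK₁, hK₂, hKc⟩ := exists_glue Q _ hQP
    (c := fun p ↦ ENNReal.ofReal (dist p.1 p.2))
    (c₁ := fun p ↦ ENNReal.ofReal (dist p.1 (ι p.2)))
    (c₂ := fun p ↦ ENNReal.ofReal (dist (ι p.1) p.2))
    (fun _ ↦ ENNReal.ofReal_ne_top) (fun _ _ _ ↦ htri _ _ _)
  have htransit : ∫⁻ p, ENNReal.ofReal (dist p.1 (ι p.2)) ∂s.transit ≤
      ENNReal.ofReal ε * β univ :=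
    (lintegral_map_le _ _).trans <| (lintegral_mono hεD).trans_eq (lintegral_const _)
  have hplan : ∫⁻ p, ENNReal.ofReal (dist (ι p.1) (ι p.2)) ∂s.plan ≤
      ∫⁻ p, ENNReal.ofReal (dist p.1 p.2) ∂π + 2 * ENNReal.ofReal ε * π univ := by
    refine (lintegral_map_le _ _).trans ?_
    rw [← lintegral_const, ← lintegral_add_right _ measurable_const]
    refine lintegral_mono fun p ↦ ?_
    calc ENNReal.ofReal (dist (ι (D p.1)) (ι (D p.2)))
        ≤ ENNReal.ofReal (dist (ι (D p.1)) p.1) + (ENNReal.ofReal (dist p.1 p.2) +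
          ENNReal.ofReal (dist p.2 (ι (D p.2)))) := (htri _ _ _).trans (by gcongr; exact htri _ _ _)
      _ ≤ ENNReal.ofReal ε + (ENNReal.ofReal (dist p.1 p.2) + ENNReal.ofReal ε) := by
        gcongr
        · rw [dist_comm]
          exact hε _
        · exact hε _
      _ = ENNReal.ofReal (dist p.1 p.2) + 2 * ENNReal.ofReal ε := by ring
  have hend : ∫⁻ p, ENNReal.ofReal (dist (ι p.1) p.2) ∂(γ.map fun x ↦ (D x, x)) ≤
      ENNReal.ofReal ε * γ univ := by
    refine (lintegral_map_le _ _).trans <| (lintegral_mono fun x ↦ ?_).trans_eq (lintegral_const _)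
    rw [dist_comm]
    exact hεD x
  calc wassersteinDist β γ ≤ ∫⁻ p, ENNReal.ofReal (dist p.1 p.2) ∂K :=
        iInf_le_of_le K <| iInf₂_le (hK₁.trans (hQ₁.trans hβ)) (hK₂.trans hγ)
    _ ≤ (ENNReal.ofReal ε * β univ + (∫⁻ p, ENNReal.ofReal (dist p.1 p.2) ∂π +
          2 * ENNReal.ofReal ε * π univ)) + ENNReal.ofReal ε * γ univ :=
        hKc.trans (add_le_add (hQc.trans (add_le_add htransit hplan)) hend)
    _ = _ := by ring

end Transport

/-- Monotonicity of the Wasserstein-1 distance under addition of a common measure: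
`W(α + β, α + γ) ≥ W(β, γ)` for finite Borel measures with `β, γ` of equal total mass. -/
theorem wasserstein_add_left_mono
    {X : Type*} [MetricSpace X] [MeasurableSpace X] [BorelSpace X]
    (α β γ : Measure X) [IsFiniteMeasure α] [IsFiniteMeasure β] [IsFiniteMeasure γ]
    (hmass : β Set.univ = γ Set.univ) :
    wassersteinDist β γ ≤ wassersteinDist (α + β) (α + γ) := by
  refine le_iInf fun π ↦ le_iInf₂ fun hπ₁ hπ₂ ↦ ?_
  set M := β Set.univ + 2 * π Set.univ + γ Set.univ
  have hM : M ≠ ∞ := by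
    have : π Set.univ ≠ ∞ := by
      rw [← map_fst_univ, hπ₁]
      exact measure_ne_top _ _
    simp [M, this, ENNReal.mul_eq_top]
  have hle : ∀ ε : ℝ, 0 < ε → wassersteinDist β γ ≤
      ∫⁻ p, ENNReal.ofReal (dist p.1 p.2) ∂π + ENNReal.ofReal ε * M := by
    intro ε hε
    obtain ⟨D, hdist, hD⟩ := exists_dist_lt_forall_measurableSet_preimage X hε
    let _ : MeasurableSpace (ULift.{0} X) := ⊤
    have : DiscreteMeasurableSpace (ULift.{0} X) := ⟨fun _ ↦ trivial⟩
    have hmeas : Measurable (ULift.up.{0} ∘ D) := fun S _ ↦ hD (ULift.up ⁻¹' S)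
    exact wassersteinDist_le_of_discretization hmeas ULift.down (fun x ↦ (hdist x).le) hmass hπ₁ hπ₂
  have hlim : Filter.Tendsto
      (fun ε : ℝ ↦ ∫⁻ p, ENNReal.ofReal (dist p.1 p.2) ∂π + ENNReal.ofReal ε * M)
      (nhdsWithin 0 (Set.Ioi 0)) (nhds (∫⁻ p, ENNReal.ofReal (dist p.1 p.2) ∂π + 0)) := by
    refine tendsto_const_nhds.add ?_
    have h := ENNReal.Tendsto.mul_const (b := M)
      (ENNReal.tendsto_ofReal (Filter.tendsto_id (α := ℝ) (x := nhds 0))) (.inr hM)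
    simp only [ENNReal.ofReal_zero, zero_mul] at h
    exact h.mono_left nhdsWithin_le_nhds
  rw [add_zero] at hlim
  exact ge_of_tendsto hlim (eventually_nhdsWithin_of_forall fun ε hε ↦ hle ε hε)
end
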